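/- arXiv:1911.12541 — 2 statements merged into one kernel-verified Lean document; each statement's English description precedes it below -/
import Mathlib

section
/- Let n ≥ 4 be even and let Θ(j,k) be the graph obtained from the odd cycle 𝒞 = v₁v₂⋯v_{n-1}v₁ by adding a vertex v₀ adjacent to v_j and v_k, 1 ≤ j < k ≤ n-1. Then q(Θ) ≤ q(Θ(j,k)), with equality if and only if Θ(j,k) ≅ Θ, where Θ = Θ(2, n-1). -/
open Matrix SimpleGraph
open scoped Classical

/-- The signless Laplacian matrix `Q(G) = D(G) + A(G)` of a simple graph. -/
noncomputable def signlessLaplacian {V : Type*} [Fintype V] (G : SimpleGraph V) :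
    Matrix V V ℝ := fun i j =>
  (if i = j then ((G.neighborSet i).ncard : ℝ) else 0) + (if G.Adj i j then 1 else 0)

/-- The least eigenvalue `q(G)` of the signless Laplacian of `G`. -/
noncomputable def leastQEig {V : Type*} [Fintype V] (G : SimpleGraph V) : ℝ :=
  sInf {μ : ℝ | ∃ x : V → ℝ, x ≠ 0 ∧ (signlessLaplacian G).mulVec x = μ • x}

/-- A graph is 2-connected if it has at least 3 vertices and no cut vertex. -/
def TwoConnected {V : Type*} [Fintype V] (G : SimpleGraph V) : Prop :=
  3 ≤ Fintype.card V ∧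
    ∀ v : V, (((⊤ : G.Subgraph).deleteVerts {v}).coe).Connected

/-- The cycle `C_n` on vertices `v_0, …, v_{n-1}`. -/
def cycleG (n : ℕ) : SimpleGraph (Fin n) :=
  SimpleGraph.fromRel (fun i j => (i.val + 1) % n = j.val)

/-- `H(i₁,…,i_k)`: the cycle `C_n` together with the chords `v_i v_{n-i}` for `i ∈ S`. -/
def Hgraph (n : ℕ) (S : Finset ℕ) : SimpleGraph (Fin n) :=
  cycleG n ⊔ SimpleGraph.fromRel (fun a b => ∃ i ∈ S, a.val = i ∧ b.val = n - i)

/-- `Θ(j,k)`: the odd cycle `v₁v₂⋯v_{n-1}v₁` plus a vertex `v₀` adjacent to `v_j` and `v_k`. -/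
def thetaJK (n j k : ℕ) : SimpleGraph (Fin n) :=
  SimpleGraph.fromRel (fun a b =>
    (1 ≤ a.val ∧ b.val = a.val + 1) ∨ (a.val = 1 ∧ b.val = n - 1) ∨
      (a.val = 0 ∧ (b.val = j ∨ b.val = k)))

/-- The graph `Θ = Θ(2, n-1)`. -/
def thetaG (n : ℕ) : SimpleGraph (Fin n) := thetaJK n 2 (n - 1)

lemma sl_mulVec {V : Type*} [Fintype V] (G : SimpleGraph V) (x : V → ℝ) (v : V) :
    (signlessLaplacian G).mulVec x v = ∑ w, if G.Adj v w then x v + x w else 0 := by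
  have hc : ((G.neighborSet v).ncard : ℝ) = ∑ w, if G.Adj v w then (1 : ℝ) else 0 := by
    rw [Finset.sum_boole, Set.ncard_eq_toFinset_card']
    congr 2
    ext w
    simp
  simp only [Matrix.mulVec, dotProduct, signlessLaplacian, add_mul, Finset.sum_add_distrib,
    ite_mul, zero_mul, one_mul, Finset.sum_ite_eq, Finset.mem_univ, if_true]
  rw [hc, Finset.sum_mul, ← Finset.sum_add_distrib]
  refine Finset.sum_congr rfl fun w _ => ?_
  split_ifs <;> simp

lemma eig_sub {V W : Type*} [Fintype V] [Fintype W] {G : SimpleGraph V} {H : SimpleGraph W}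
    (e : G ≃g H) (μ : ℝ) (h : ∃ x : V → ℝ, x ≠ 0 ∧ (signlessLaplacian G).mulVec x = μ • x) :
    ∃ x : W → ℝ, x ≠ 0 ∧ (signlessLaplacian H).mulVec x = μ • x := by
  obtain ⟨x, hx, h⟩ := h
  refine ⟨fun w => x (e.symm w), ?_, ?_⟩
  · intro h0
    apply hx
    funext v
    have := congrFun h0 (e v)
    simpa using this
  · funext w
    have := congrFun h (e.symm w)
    rw [sl_mulVec] at this ⊢
    simp only [Pi.smul_apply] at this ⊢
    rw [← this]
    rw [← Equiv.sum_comp e.toEquiv]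
    refine Finset.sum_congr rfl fun v _ => ?_
    have h1 : H.Adj w (e.toEquiv v) ↔ G.Adj (e.symm w) v := by
      rw [← e.map_adj_iff]; simp
    have h2 : e.symm (e.toEquiv v) = v := e.symm_apply_apply v
    simp only [h1, h2]

lemma leastQEig_iso {V W : Type*} [Fintype V] [Fintype W] {G : SimpleGraph V} {H : SimpleGraph W}
    (e : G ≃g H) : leastQEig G = leastQEig H := by
  unfold leastQEig
  congr 1
  ext μ
  exact ⟨eig_sub e μ, eig_sub e.symm μ⟩

lemma eig_nonempty {V : Type*} [Fintype V] [Nonempty V] (G : SimpleGraph V) :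
    {μ : ℝ | ∃ x : V → ℝ, x ≠ 0 ∧ (signlessLaplacian G).mulVec x = μ • x}.Nonempty := by
  have hA : (signlessLaplacian G).IsHermitian := by
    ext i j
    simp only [Matrix.conjTranspose_apply, signlessLaplacian, star_trivial, G.adj_comm j i]
    by_cases h : i = j
    · subst h; rfl
    · simp [h, Ne.symm h]
  obtain ⟨i⟩ := ‹Nonempty V›
  refine ⟨hA.eigenvalues i, ⇑(hA.eigenvectorBasis i), ?_, hA.mulVec_eigenvectorBasis i⟩
  intro h0
  have h1 := hA.eigenvectorBasis.orthonormal.ne_zero i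
  apply h1
  ext v
  exact congrFun h0 v

lemma rot_fact (n r v w : ℕ) (hn : 4 ≤ n) (hr : r < n - 1) (_hv : v < n)
    (h : w = if v = 0 then 0 else if r < v then v - r else v + (n - 1) - r) :
    (v = 0 ∧ w = 0) ∨ (r < v ∧ w + r = v ∧ 1 ≤ w) ∨
      (1 ≤ v ∧ v ≤ r ∧ w + r + 1 = v + n ∧ 1 ≤ w) := by
  split_ifs at h <;> omega

set_option maxHeartbeats 4000000 in
lemma rot_aux (n j k j' k' r a b A B : ℕ) (hn : 4 ≤ n) (hr : r < n - 1)
    (hj : 1 ≤ j) (hj2 : j ≤ n - 1) (hk : 1 ≤ k) (hk2 : k ≤ n - 1) (ha : a < n) (hb : b < n)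
    (hab : a ≠ b)
    (h1 : j' = if r < j then j - r else j + (n - 1) - r)
    (h2 : k' = if r < k then k - r else k + (n - 1) - r)
    (h3 : A = if a = 0 then 0 else if r < a then a - r else a + (n - 1) - r)
    (h4 : B = if b = 0 then 0 else if r < b then b - r else b + (n - 1) - r) :
    (((1 ≤ A ∧ B = A + 1) ∨ (A = 1 ∧ B = n - 1) ∨ (A = 0 ∧ (B = j' ∨ B = k'))) ∨
     ((1 ≤ B ∧ A = B + 1) ∨ (B = 1 ∧ A = n - 1) ∨ (B = 0 ∧ (A = j' ∨ A = k')))) ↔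
    (((1 ≤ a ∧ b = a + 1) ∨ (a = 1 ∧ b = n - 1) ∨ (a = 0 ∧ (b = j ∨ b = k))) ∨
     ((1 ≤ b ∧ a = b + 1) ∨ (b = 1 ∧ a = n - 1) ∨ (b = 0 ∧ (a = j ∨ a = k)))) := by
  have f1 := rot_fact n r j j' hn hr (by omega) (by rw [h1, if_neg (by omega : ¬ j = 0)])
  have f2 := rot_fact n r k k' hn hr (by omega) (by rw [h2, if_neg (by omega : ¬ k = 0)])
  have f3 := rot_fact n r a A hn hr ha h3
  have f4 := rot_fact n r b B hn hr hb h4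
  clear h1 h2 h3 h4
  have e1 : B = j' ↔ b = j := by omega
  have e2 : B = k' ↔ b = k := by omega
  have e3 : A = j' ↔ a = j := by omega
  have e4 : A = k' ↔ a = k := by omega
  rw [e1, e2, e3, e4]
  clear e1 e2 e3 e4 f1 f2
  rcases f3 with f3 | f3 | f3 <;> rcases f4 with f4 | f4 | f4 <;> constructor <;>
    rintro ((h | h | h) | (h | h | h)) <;> omega

/-- rotations of the cycle give isomorphisms -/
lemma theta_rot (n j k j' k' r : ℕ) (hn : 4 ≤ n) (hr : r < n - 1) 
    (hj : 1 ≤ j) (hj2 : j ≤ n - 1) (hk : 1 ≤ k) (hk2 : k ≤ n - 1)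
    (h1 : j' = if r < j then j - r else j + (n - 1) - r)
    (h2 : k' = if r < k then k - r else k + (n - 1) - r) :
    Nonempty (thetaJK n j k ≃g thetaJK n j' k') := by
  let f : Fin n → Fin n := fun v =>
    ⟨if v.val = 0 then 0 else if r < v.val then v.val - r else v.val + (n - 1) - r, by
      have := v.isLt
      split_ifs <;> omega⟩
  have hf : ∀ v : Fin n, (f v).val = 
    if v.val = 0 then 0 else if r < v.val then v.val - r else v.val + (n - 1) - r := fun v => rfl
  have hinj : Function.Injective f := by
    intro a b hab
    have h := congrArg Fin.val hab
    rw [hf, hf] at h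
    ext
    have := a.isLt
    have := b.isLt
    split_ifs at h <;> omega
  have hb : Function.Bijective f := Finite.injective_iff_bijective.mp hinj
  refine ⟨⟨Equiv.ofBijective f hb, ?_⟩⟩
  intro a b
  have hne : f a ≠ f b ↔ a ≠ b := hinj.ne_iff
  simp only [Equiv.ofBijective_apply, thetaJK, SimpleGraph.fromRel_adj, hne, hf]
  refine and_congr_right fun hab => ?_
  have hab' : a.val ≠ b.val := fun h => hab (Fin.ext h)
  exact rot_aux n j k j' k' r a.val b.val _ _ hn hr hj hj2 hk hk2 a.isLt b.isLt hab' h1 h2 rfl rfl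

lemma theta_swap (n j k : ℕ) : thetaJK n j k = thetaJK n k j := by
  unfold thetaJK
  congr 1
  funext a b
  simp only [or_comm]

/-- every theta graph is isomorphic to a canonical one -/
lemma theta_canon (n j k : ℕ) (hn : 4 ≤ n) (heven : Even n)
    (hj : 1 ≤ j) (hjk : j < k) (hk : k ≤ n - 1) :
    ∃ a, Even a ∧ 2 ≤ a ∧ a + 1 ≤ n - 1 ∧ Nonempty (thetaJK n j k ≃g thetaJK n 1 (a + 1)) := by
  rcases Nat.even_or_odd (k - j) with h | h
  · refine ⟨k - j, h, ?_, ?_, theta_rot n j k 1 (k - j + 1) (j - 1) hn (by omega) hj (by omega)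
      (by omega) hk ?_ ?_⟩
    · obtain ⟨c, hc⟩ := h
      omega
    · obtain ⟨c, hc⟩ := h
      obtain ⟨d, hd⟩ := heven
      omega
    · split_ifs <;> omega
    · split_ifs <;> omega
  · obtain ⟨c, hc⟩ := h
    obtain ⟨d, hd⟩ := heven
    refine ⟨n - 1 - (k - j), ⟨d - 1 - c, by omega⟩, by omega, by omega, ?_⟩
    rw [theta_swap n 1]
    refine theta_rot n j k _ 1 (k - 1) hn (by omega) hj (by omega)
      (by omega) hk ?_ ?_
    · split_ifs <;> omega
    · split_ifs <;> omega

lemma path_form (t : ℝ) (z : ℕ → ℝ) (m : ℕ) (hpos : ∀ i, 1 ≤ i → i ≤ m + 1 → 0 < Real.sin (i * t)) :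
    (1 - Real.cos t + Real.sin t * (Real.cos ((m + 1 : ℕ) * t) / Real.sin ((m + 1 : ℕ) * t))) *
      (z 0 ^ 2 + z (m + 1) ^ 2)
      - 2 * (Real.sin t / Real.sin ((m + 1 : ℕ) * t)) * ((-1) ^ (m + 1) * z 0 * z (m + 1)) ≤
    ∑ i ∈ Finset.range (m + 1), (z i + z (i + 1)) ^ 2
      - (2 - 2 * Real.cos t) * ∑ i ∈ Finset.range m, z (i + 1) ^ 2 := by
  induction m with
  | zero =>
    have h := hpos 1 le_rfl le_rfl
    simp only [Nat.cast_one, one_mul] at h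
    have h1 := h.ne'
    simp
    apply le_of_eq
    field_simp
    ring
  | succ m ih =>
    have ih := ih (fun i h1 h2 => hpos i h1 (by omega))
    rw [Finset.sum_range_succ _ (m + 1), Finset.sum_range_succ (fun i => z (i + 1) ^ 2) m]
    have hS := hpos (m + 1) (by omega) (by omega)
    have hS' := hpos (m + 2) (by omega) (by omega)
    have e1 : ((m + 1 + 1 : ℕ) : ℝ) * t = (m + 1 : ℕ) * t + t := by push_cast; ring
    have e2 : ((m + 2 : ℕ) : ℝ) * t = (m + 1 : ℕ) * t + t := by push_cast; ring
    rw [e2, Real.sin_add] at hS'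
    rw [e1, Real.sin_add, Real.cos_add]
    have h1 := Real.sin_sq_add_cos_sq t
    have h2 := Real.sin_sq_add_cos_sq ((m + 1 : ℕ) * t)
    have hsg : ((-1 : ℝ) ^ (m + 1)) ^ 2 = 1 := by
      rw [← pow_mul, mul_comm, pow_mul]; simp
    have hsg2 : (-1 : ℝ) ^ (m + 1 + 1) = - (-1 : ℝ) ^ (m + 1) := by rw [pow_succ]; ring
    rw [hsg2]
    generalize (-1 : ℝ) ^ (m + 1) = g at *
    generalize Real.sin ((m + 1 : ℕ) * t) = S at *
    generalize Real.cos ((m + 1 : ℕ) * t) = C at *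
    generalize Real.sin t = s at *
    generalize Real.cos t = c at *
    generalize z 0 = x at *
    generalize z (m + 1) = y at *
    generalize z (m + 1 + 1) = w at *
    generalize ∑ i ∈ Finset.range (m + 1), (z i + z (i + 1)) ^ 2 = A at *
    generalize ∑ i ∈ Finset.range m, z (i + 1) ^ 2 = B at *
    have key : (1 - c + s * (C / S)) * (x ^ 2 + y ^ 2) - 2 * (s / S) * (g * x * y)
        + ((y + w) ^ 2 - (2 - 2 * c) * y ^ 2)
        - ((1 - c + s * ((C * c - S * s) / (S * c + C * s))) * (x ^ 2 + w ^ 2)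
          - 2 * (s / (S * c + C * s)) * (-g * x * w))
        = ((S * c + C * s) * y - (s * g * x - S * w)) ^ 2 / (S * (S * c + C * s)) := by
      have hS1 := hS.ne'
      obtain ⟨D, hD⟩ : ∃ D, D = S * c + C * s := ⟨_, rfl⟩
      have hD1 : D ≠ 0 := by rw [hD]; exact hS'.ne'
      rw [← hD]
      field_simp
      rw [hD]
      linear_combination (s ^ 2 * x ^ 2) * h2 + (S ^ 2 * w ^ 2) * h1 - (s ^ 2 * x ^ 2) * hsg
    have : 0 ≤ ((S * c + C * s) * y - (s * g * x - S * w)) ^ 2 / (S * (S * c + C * s)) := by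
      positivity
    linarith

lemma quad_rel (n : ℕ) (R : ℕ → ℕ → Prop) (hR : ∀ a b, R a b → a < b) (X : ℕ → ℝ) :
    ∑ v : Fin n, X v * (signlessLaplacian (SimpleGraph.fromRel
      (fun a b : Fin n => R a.val b.val))).mulVec (fun v => X v) v =
    ∑ a ∈ Finset.range n, ∑ b ∈ Finset.range n, if R a b then (X a + X b) ^ 2 else 0 := by
  rw [← Fin.sum_univ_eq_sum_range (fun a => ∑ b ∈ Finset.range n,
    if R a b then (X a + X b) ^ 2 else 0)]
  have h1 : ∀ v : Fin n, X v * (signlessLaplacian (SimpleGraph.fromRel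
      (fun a b : Fin n => R a.val b.val))).mulVec (fun v => X v) v =
      (∑ w : Fin n, if R v w then X v * (X v + X w) else 0) +
      (∑ w : Fin n, if R w v then X v * (X v + X w) else 0) := by
    intro v
    rw [sl_mulVec, Finset.mul_sum, ← Finset.sum_add_distrib]
    refine Finset.sum_congr rfl fun w _ => ?_
    simp only [SimpleGraph.fromRel_adj]
    by_cases a : R v w
    · have h := hR _ _ a
      have b : ¬ R w v := fun h' => by have := hR _ _ h'; omega
      have c : v ≠ w := by rintro rfl; omega
      simp [a, b, c]
    · by_cases b : R w v
      · have h := hR _ _ b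
        have c : v ≠ w := by rintro rfl; omega
        simp [a, b, c]
      · simp [a, b]
  rw [Finset.sum_congr rfl fun v _ => h1 v, Finset.sum_add_distrib]
  rw [Finset.sum_comm (f := fun v w : Fin n => if R w v then X v * (X v + X w) else 0)]
  rw [← Finset.sum_add_distrib]
  refine Finset.sum_congr rfl fun v _ => ?_
  rw [← Fin.sum_univ_eq_sum_range (fun b => if R v b then (X v + X b) ^ 2 else 0),
    ← Finset.sum_add_distrib]
  refine Finset.sum_congr rfl fun w _ => ?_
  split_ifs <;> ring

lemma quad_theta (M j k : ℕ) (hM : 2 ≤ M) (hj : 1 ≤ j) (hjk : j < k) (hk : k ≤ M + 1) (X : ℕ → ℝ) :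
    ∑ v : Fin (M + 2), X v * (signlessLaplacian (thetaJK (M + 2) j k)).mulVec (fun v => X v) v =
    ∑ i ∈ Finset.range M, (X (i + 1) + X (i + 2)) ^ 2 + (X 1 + X (M + 1)) ^ 2 +
      (X 0 + X j) ^ 2 + (X 0 + X k) ^ 2 := by
  have h := quad_rel (M + 2) (fun a b => (1 ≤ a ∧ b = a + 1) ∨ (a = 1 ∧ b = M + 2 - 1) ∨
      (a = 0 ∧ (b = j ∨ b = k))) (by intro a b h; omega) X
  refine h.trans ?_
  have h2 : ∀ a ∈ Finset.range (M + 2), ∀ b ∈ Finset.range (M + 2),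
      (if (1 ≤ a ∧ b = a + 1) ∨ (a = 1 ∧ b = M + 2 - 1) ∨
      (a = 0 ∧ (b = j ∨ b = k)) then (X a + X b) ^ 2 else 0) =
      (if b = a + 1 then (if 1 ≤ a then (X a + X b) ^ 2 else 0) else 0) +
      (if b = M + 1 then (if a = 1 then (X a + X b) ^ 2 else 0) else 0) +
      (if b = j then (if a = 0 then (X a + X b) ^ 2 else 0) else 0) +
      (if b = k then (if a = 0 then (X a + X b) ^ 2 else 0) else 0) := by
    intro a ha b hb
    split_ifs <;> first | omega | simp
  refine (Finset.sum_congr rfl fun a ha => Finset.sum_congr rfl fun b hb =>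
    Eq.trans (by congr) (h2 a ha b hb)).trans ?_
  simp only [Finset.sum_add_distrib, Finset.sum_ite_eq', Finset.mem_range]
  have hj' : j < M + 2 := by omega
  have hk' : k < M + 2 := by omega
  simp only [hj', hk', if_true, show M + 1 < M + 2 by omega]
  simp only [Finset.sum_ite_eq', Finset.mem_range, show 1 < M + 2 by omega, show 0 < M + 2 by omega,
    if_true]
  congr 3
  rw [Finset.sum_range_succ', Finset.sum_range_succ]
  simp
  refine Finset.sum_congr rfl fun i hi => ?_
  rw [if_pos (Finset.mem_range.mp hi)]

/-- the secular function of a theta graph -/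
noncomputable def secF (a b : ℕ) (t : ℝ) : ℝ :=
  Real.sin t / Real.cos t - Real.sin (t / 2) / Real.cos (t / 2)
    + Real.sin (a * t / 2) / Real.cos (a * t / 2) - Real.cos (b * t / 2) / Real.sin (b * t / 2)

lemma half1 (y : ℝ) (h1 : Real.sin (y / 2) ≠ 0) (h2 : Real.cos (y / 2) ≠ 0) :
    Real.cos y / Real.sin y - 1 / Real.sin y = - (Real.sin (y / 2) / Real.cos (y / 2)) := by
  have e : y = 2 * (y / 2) := by ring
  have hs : Real.sin y = 2 * Real.sin (y / 2) * Real.cos (y / 2) := by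
    conv_lhs => rw [e, Real.sin_two_mul]
  have hc : Real.cos y = 2 * Real.cos (y / 2) ^ 2 - 1 := by
    conv_lhs => rw [e, Real.cos_two_mul]
  rw [hs, hc]
  have := Real.sin_sq_add_cos_sq (y / 2)
  field_simp
  linear_combination 2 * this

lemma half2 (y : ℝ) (h1 : Real.sin (y / 2) ≠ 0) (h2 : Real.cos (y / 2) ≠ 0) :
    Real.cos y / Real.sin y + 1 / Real.sin y = Real.cos (y / 2) / Real.sin (y / 2) := by
  have e : y = 2 * (y / 2) := by ring
  have hs : Real.sin y = 2 * Real.sin (y / 2) * Real.cos (y / 2) := by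
    conv_lhs => rw [e, Real.sin_two_mul]
  have hc : Real.cos y = 2 * Real.cos (y / 2) ^ 2 - 1 := by
    conv_lhs => rw [e, Real.cos_two_mul]
  rw [hs, hc]
  field_simp
  ring

lemma half3 (y : ℝ) (h2 : Real.cos (y / 2) ≠ 0) :
    1 - Real.cos y = Real.sin y * (Real.sin (y / 2) / Real.cos (y / 2)) := by
  have e : y = 2 * (y / 2) := by ring
  have hs : Real.sin y = 2 * Real.sin (y / 2) * Real.cos (y / 2) := by
    conv_lhs => rw [e, Real.sin_two_mul]
  have hc : Real.cos y = 2 * Real.cos (y / 2) ^ 2 - 1 := by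
    conv_lhs => rw [e, Real.cos_two_mul]
  rw [hs, hc]
  have := Real.sin_sq_add_cos_sq (y / 2)
  field_simp
  linear_combination -2 * this

lemma coef (a b : ℕ) (ha : 1 ≤ a) (hb : 1 ≤ b) (hab : 3 ≤ a + b) (t : ℝ) (ht : 0 < t)
    (ht2 : (a + b) * t < Real.pi) (hF : secF a b t ≤ 0) (A B : ℝ)
    (hA : A = 1 - Real.cos t + Real.sin t * (Real.cos (2 * t) / Real.sin (2 * t)
      + Real.cos (a * t) / Real.sin (a * t) + Real.cos (b * t) / Real.sin (b * t)))
    (hB : B = Real.sin t * (1 / Real.sin (2 * t)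
      + 1 / Real.sin (a * t) - 1 / Real.sin (b * t))) : 0 ≤ A - B ∧ 0 ≤ A + B := by
  have ha' : (1 : ℝ) ≤ a := by exact_mod_cast ha
  have hb' : (1 : ℝ) ≤ b := by exact_mod_cast hb
  have hab' : (3 : ℝ) ≤ a + b := by exact_mod_cast hab
  have hpi := Real.pi_pos
  have hat : 0 < a * t := by positivity
  have hbt : 0 < b * t := by positivity
  have h3t : 3 * t ≤ (a + b) * t := by gcongr
  have hsum : a * t + b * t < Real.pi := by linarith
  have hs : 0 < Real.sin t := Real.sin_pos_of_pos_of_lt_pi ht (by linarith)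
  have hc : 0 < Real.cos t := Real.cos_pos_of_mem_Ioo ⟨by linarith, by linarith⟩
  have s1 : 0 < Real.sin (t / 2) := Real.sin_pos_of_pos_of_lt_pi (by linarith) (by linarith)
  have c1 : 0 < Real.cos (t / 2) := Real.cos_pos_of_mem_Ioo ⟨by linarith, by linarith⟩
  have sa : 0 < Real.sin (a * t / 2) := Real.sin_pos_of_pos_of_lt_pi (by linarith) (by linarith)
  have ca : 0 < Real.cos (a * t / 2) := Real.cos_pos_of_mem_Ioo ⟨by linarith, by linarith⟩
  have sb : 0 < Real.sin (b * t / 2) := Real.sin_pos_of_pos_of_lt_pi (by linarith) (by linarith)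
  have cb : 0 < Real.cos (b * t / 2) := Real.cos_pos_of_mem_Ioo ⟨by linarith, by linarith⟩
  have e2 : 2 * t / 2 = t := by ring
  have p1 := half1 (2 * t) (by rw [e2]; exact hs.ne') (by rw [e2]; exact hc.ne')
  have p2 := half2 (2 * t) (by rw [e2]; exact hs.ne') (by rw [e2]; exact hc.ne')
  rw [e2] at p1 p2
  have q1 := half1 (a * t) sa.ne' ca.ne'
  have q2 := half2 (a * t) sa.ne' ca.ne'
  have r1 := half1 (b * t) sb.ne' cb.ne'
  have r2 := half2 (b * t) sb.ne' cb.ne'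
  have w := half3 t c1.ne'
  constructor
  · have : A - B = Real.sin t * (- secF a b t) := by
      rw [hA, hB, w]
      unfold secF
      linear_combination Real.sin t * (p1 + q1 + r2)
    rw [this]
    apply mul_nonneg hs.le
    linarith
  · have h1 : A + B = Real.sin t * (Real.sin (t / 2) / Real.cos (t / 2) + Real.cos t / Real.sin t +
        (Real.cos (a * t / 2) / Real.sin (a * t / 2) -
          Real.sin (b * t / 2) / Real.cos (b * t / 2))) := by
      rw [hA, hB, w]
      linear_combination Real.sin t * (p2 + q2 + r1)
    have h2 : Real.cos (a * t / 2) / Real.sin (a * t / 2) -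
          Real.sin (b * t / 2) / Real.cos (b * t / 2) =
          Real.cos (a * t / 2 + b * t / 2) / (Real.sin (a * t / 2) * Real.cos (b * t / 2)) := by
      rw [Real.cos_add, div_sub_div _ _ sa.ne' cb.ne']
    have h3 : 0 < Real.cos (a * t / 2 + b * t / 2) :=
      Real.cos_pos_of_mem_Ioo ⟨by linarith, by linarith⟩
    rw [h1, h2]
    positivity

lemma eig_lower (a b : ℕ) (ha : Even (a + 1)) (hb : Odd (b + 1)) (ha1 : 1 ≤ a) 
    (t : ℝ) (ht : 0 < t) (ht2 : ((a + 1 : ℕ) + (b + 1 : ℕ)) * t < Real.pi)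
    (hF : secF (a + 1) (b + 1) t ≤ 0) (μ : ℝ) (x : Fin (a + b + 3) → ℝ) (hx : x ≠ 0)
    (hμ : (signlessLaplacian (thetaJK (a + b + 3) 1 (a + 2))).mulVec x = μ • x) :
    2 - 2 * Real.cos t ≤ μ := by
  obtain ⟨X, hX⟩ : ∃ X : ℕ → ℝ, x = fun v => X v.val :=
    ⟨fun i => if h : i < a + b + 3 then x ⟨i, h⟩ else 0, by funext v; simp⟩
  have hq := quad_theta (a + b + 1) 1 (a + 2) (by omega) le_rfl (by omega) (by omega) X
  change ∑ v : Fin (a + b + 3), X v * (signlessLaplacian (thetaJK (a + b + 3) 1 (a + 2))).mulVec 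
    (fun v => X v) v = _ at hq
  rw [← hX, hμ] at hq
  have hpos : 0 < ∑ v : Fin (a + b + 3), x v ^ 2 := by
    obtain ⟨v, hv⟩ : ∃ v, x v ≠ 0 := by
      by_contra! h
      exact hx (funext h)
    exact Finset.sum_pos' (fun i _ => sq_nonneg _) ⟨v, Finset.mem_univ _, by positivity⟩
  have hl : ∑ v : Fin (a + b + 3), X v * (μ • x) v = μ * ∑ v : Fin (a + b + 3), x v ^ 2 := by
    rw [Finset.mul_sum]
    refine Finset.sum_congr rfl fun v _ => ?_
    rw [hX]
    simp
    ring
  rw [hl] at hq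
  have hn : ∑ v : Fin (a + b + 3), x v ^ 2 = X 0 ^ 2 + X 1 ^ 2 + X (a + 2) ^ 2 +
      ∑ i ∈ Finset.range a, X (i + 2) ^ 2 + ∑ i ∈ Finset.range b, X (a + 1 + i + 2) ^ 2 := by
    rw [hX, Fin.sum_univ_eq_sum_range (fun i => X i ^ 2), Finset.sum_range_succ',
      Finset.sum_range_succ', show a + b + 1 = a + 1 + b by ring, Finset.sum_range_add,
      Finset.sum_range_succ]
    ring
  have ha' : (1 : ℝ) ≤ (a + 1 : ℕ) := by exact_mod_cast (by omega : 1 ≤ a + 1)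
  have hb' : (1 : ℝ) ≤ (b + 1 : ℕ) := by exact_mod_cast (by omega : 1 ≤ b + 1)
  have hsin : ∀ i : ℕ, 1 ≤ i → i ≤ a + b + 2 → 0 < Real.sin (i * t) := by
    intro i h1 h2
    apply Real.sin_pos_of_pos_of_lt_pi
    · have : (0 : ℝ) < i := by exact_mod_cast h1
      positivity
    · refine lt_of_le_of_lt ?_ ht2
      gcongr
      exact_mod_cast (by omega : i ≤ (a + 1) + (b + 1))
  have P1 := path_form t (fun i => X (i + 1)) a (fun i h1 h2 => hsin i h1 (by omega))
  have P2 := path_form t (fun i => if i = b + 1 then X 1 else X (a + 2 + i)) b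
    (fun i h1 h2 => hsin i h1 (by omega))
  have P3 := path_form t (fun i => if i = 0 then X 1 else if i = 1 then X 0 else X (a + 2)) 1
    (fun i h1 h2 => hsin i h1 (by omega))
  rw [ha.neg_one_pow] at P1
  rw [hb.neg_one_pow] at P2
  have S1 : ∑ i ∈ Finset.range (b + 1), ((if i = b + 1 then X 1 else X (a + 2 + i)) +
      (if i + 1 = b + 1 then X 1 else X (a + 2 + (i + 1)))) ^ 2 =
      ∑ i ∈ Finset.range b, (X (a + 1 + i + 1) + X (a + 1 + i + 2)) ^ 2 +
        (X 1 + X (a + b + 2)) ^ 2 := by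
    rw [Finset.sum_range_succ]
    congr 1
    · refine Finset.sum_congr rfl fun i hi => ?_
      have := Finset.mem_range.mp hi
      rw [if_neg (by omega), if_neg (by omega)]
      congr 3 <;> ring
    · rw [if_neg (by omega), if_pos rfl, add_comm]
      congr 3; ring
  have S2 : ∑ i ∈ Finset.range b, (if i + 1 = b + 1 then X 1 else X (a + 2 + (i + 1))) ^ 2 =
      ∑ i ∈ Finset.range b, X (a + 1 + i + 2) ^ 2 := by
    refine Finset.sum_congr rfl fun i hi => ?_
    have := Finset.mem_range.mp hi
    rw [if_neg (by omega)]
    congr 2; ring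
  have S3 : ∑ i ∈ Finset.range (a + b + 1), (X (i + 1) + X (i + 2)) ^ 2 =
      ∑ i ∈ Finset.range (a + 1), (X (i + 1) + X (i + 2)) ^ 2 +
      ∑ i ∈ Finset.range b, (X (a + 1 + i + 1) + X (a + 1 + i + 2)) ^ 2 := by
    rw [show a + b + 1 = a + 1 + b by ring, Finset.sum_range_add]
  simp only [S1, S2] at P2
  simp [Finset.sum_range_succ] at P3
  rw [S3, show a + b + 1 + 1 = a + b + 2 by ring] at hq
  simp only [if_true, if_neg (by omega : ¬ (0 = b + 1)), add_zero, zero_add] at P1 P2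
  obtain ⟨hAB1, hAB2⟩ := coef (a + 1) (b + 1) (by omega) (by omega) (by omega) t ht ht2 hF _ _ rfl rfl
  rw [show a + 1 + 1 = a + 2 by ring] at P1
  simp only [show ∀ i, i + 1 + 1 = i + 2 from fun i => by ring] at P1
  rw [hn] at hq hpos
  by_contra hlt
  push Not at hlt
  have hfin := mul_lt_mul_of_pos_right hlt hpos
  have n1 := mul_nonneg hAB1 (sq_nonneg (X 1 + X (a + 2)))
  have n2 := mul_nonneg hAB2 (sq_nonneg (X 1 - X (a + 2)))
  clear hl hn
  generalize ∑ i ∈ Finset.range (a + 1), (X (i + 1) + X (i + 2)) ^ 2 = s1 at *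
  generalize ∑ i ∈ Finset.range b, (X (a + 1 + i + 1) + X (a + 1 + i + 2)) ^ 2 = s2 at *
  generalize ∑ i ∈ Finset.range a, X (i + 2) ^ 2 = s3 at *
  generalize ∑ i ∈ Finset.range b, X (a + 1 + i + 2) ^ 2 = s4 at *
  simp only [div_eq_mul_inv, one_mul] at *
  linarith

lemma eig_lower' (n A B : ℕ) (hn : n = A + B + 1) (ha : Even A) (hb : Odd B) (ha1 : 2 ≤ A)
    (t : ℝ) (ht : 0 < t) (ht2 : (A + B) * t < Real.pi)
    (hF : secF A B t ≤ 0) (μ : ℝ)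
    (hμ : ∃ x : Fin n → ℝ, x ≠ 0 ∧ (signlessLaplacian (thetaJK n 1 (A + 1))).mulVec x = μ • x) :
    2 - 2 * Real.cos t ≤ μ := by
  have hB : 1 ≤ B := hb.pos
  obtain ⟨a, rfl⟩ : ∃ a, A = a + 1 := ⟨A - 1, by omega⟩
  obtain ⟨b, rfl⟩ : ∃ b, B = b + 1 := ⟨B - 1, by omega⟩
  obtain rfl : n = a + b + 3 := by omega
  obtain ⟨x, hx, h⟩ := hμ
  exact eig_lower a b ha hb (by omega) t ht ht2 hF μ x hx h

lemma root_exists (b : ℕ) (hb : 1 ≤ b) :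
    ∃ t : ℝ, 0 < t ∧ (b + 2) * t < Real.pi ∧ secF 2 b t = 0 := by
  have hpi := Real.pi_pos
  have hb' : (1 : ℝ) ≤ b := by exact_mod_cast hb
  set T : ℝ := Real.pi / (b + 2) with hT
  have hT0 : 0 < T := by positivity
  have hTm : (b + 2) * T = Real.pi := by rw [hT]; field_simp
  have hT3 : 3 * T ≤ Real.pi := by rw [← hTm]; gcongr; linarith
  let G : ℝ → ℝ := fun t => (2 * (Real.sin t / Real.cos t) - Real.sin (t / 2) / Real.cos (t / 2))
    * Real.sin (b * t / 2) - Real.cos (b * t / 2)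
  have hcos : ∀ t, 0 ≤ t → t ≤ T → 0 < Real.cos t ∧ 0 < Real.cos (t / 2) := fun t h1 h2 =>
    ⟨Real.cos_pos_of_mem_Ioo ⟨by linarith, by linarith⟩,
      Real.cos_pos_of_mem_Ioo ⟨by linarith, by linarith⟩⟩
  have hG : ContinuousOn G (Set.Icc 0 T) := by
    intro t ht
    obtain ⟨h1, h2⟩ := hcos t ht.1 ht.2
    have h1 := h1.ne'
    have h2 := h2.ne'
    apply ContinuousAt.continuousWithinAt
    dsimp only [G]
    fun_prop (disch := assumption)
  have h0 : G 0 < 0 := by simp [G]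
  have h1 : 0 < G T := by
    obtain ⟨h1, h2⟩ := hcos T hT0.le le_rfl
    have e : b * T / 2 = Real.pi / 2 - T := by rw [← hTm]; ring
    have hs : 0 < Real.sin (T / 2) := Real.sin_pos_of_pos_of_lt_pi (by linarith) (by linarith)
    have e2 : T = 2 * (T / 2) := by ring
    have hsT : Real.sin T = 2 * Real.sin (T / 2) * Real.cos (T / 2) := by
      conv_lhs => rw [e2, Real.sin_two_mul]
    have hcT : Real.cos T = 2 * Real.cos (T / 2) ^ 2 - 1 := by
      conv_lhs => rw [e2, Real.cos_two_mul]
    have : G T = Real.sin (T / 2) / Real.cos (T / 2) := by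
      dsimp only [G]
      rw [e, Real.sin_pi_div_two_sub, Real.cos_pi_div_two_sub, sub_mul, mul_assoc,
        div_mul_cancel₀ _ h1.ne', hsT, hcT]
      field_simp
      ring
    rw [this]
    positivity
  obtain ⟨t, ht, hGt⟩ := intermediate_value_Icc hT0.le hG ⟨h0.le, h1.le⟩
  have ht0 : 0 < t := by
    rcases ht.1.lt_or_eq with h | h
    · exact h
    · rw [← h] at hGt; linarith
  have htT : t < T := by
    rcases ht.2.lt_or_eq with h | h
    · exact h
    · rw [h] at hGt; linarith
  have hbt : (b + 2) * t < Real.pi := by rw [← hTm]; gcongr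
  refine ⟨t, ht0, hbt, ?_⟩
  have hbt0 : 0 < b * t := by positivity
  have hs : 0 < Real.sin (b * t / 2) := Real.sin_pos_of_pos_of_lt_pi (by linarith) (by linarith)
  unfold secF
  have e : ((2 : ℕ) : ℝ) * t / 2 = t := by push_cast; ring
  rw [e, sub_eq_zero, eq_div_iff hs.ne']
  dsimp only [G] at hGt
  linear_combination hGt

lemma secF_lt (a b : ℕ) (ha : 1 ≤ a) (hb : 1 ≤ b) (t : ℝ) (ht : 0 < t)
    (ht2 : (a + b + 2) * t < Real.pi) : secF (a + 2) b t < secF 2 (a + b) t := by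
  have hpi := Real.pi_pos
  have ha' : 0 < a * t := by have : (1 : ℝ) ≤ a := by exact_mod_cast ha
                             positivity
  have hb' : 0 < b * t := by have : (1 : ℝ) ≤ b := by exact_mod_cast hb
                             positivity
  have key : ∀ x y : ℝ, 0 < x → 0 < y → x + y < Real.pi / 2 →
      Real.sin x / Real.cos x - Real.cos y / Real.sin y =
        - (Real.cos (x + y) / (Real.cos x * Real.sin y)) := by
    intro x y hx hy hxy
    have h1 : 0 < Real.cos x := Real.cos_pos_of_mem_Ioo ⟨by linarith, by linarith⟩
    have h2 : 0 < Real.sin y := Real.sin_pos_of_pos_of_lt_pi (by linarith) (by linarith)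
    rw [Real.cos_add, div_sub_div _ _ h1.ne' h2.ne', ← neg_div]
    congr 1
    ring
  unfold secF
  have e1 := key (((a + 2 : ℕ) : ℝ) * t / 2) (b * t / 2) (by positivity) (by positivity)
    (by push_cast; linarith)
  have e2 := key (((2 : ℕ) : ℝ) * t / 2) ((a + b : ℕ) * t / 2) (by positivity)
    (by push_cast; linarith) (by push_cast; linarith)
  have e3 : ((a + 2 : ℕ) : ℝ) * t / 2 + b * t / 2 =
    ((2 : ℕ) : ℝ) * t / 2 + (a + b : ℕ) * t / 2 := by push_cast; ring
  rw [e3] at e1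
  have hc : 0 < Real.cos (((2 : ℕ) : ℝ) * t / 2 + (a + b : ℕ) * t / 2) :=
    Real.cos_pos_of_mem_Ioo ⟨by push_cast; linarith, by push_cast; linarith⟩
  have c1 : 0 < Real.cos (((a + 2 : ℕ) : ℝ) * t / 2) :=
    Real.cos_pos_of_mem_Ioo ⟨by push_cast; linarith, by push_cast; linarith⟩
  have s1 : 0 < Real.sin (b * t / 2) := Real.sin_pos_of_pos_of_lt_pi (by linarith) (by linarith)
  have c2 : Real.cos (((a + 2 : ℕ) : ℝ) * t / 2) < Real.cos (((2 : ℕ) : ℝ) * t / 2) :=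
    Real.cos_lt_cos_of_nonneg_of_le_pi (by positivity) (by push_cast; linarith)
      (by push_cast; linarith)
  have s2 : Real.sin (b * t / 2) < Real.sin ((a + b : ℕ) * t / 2) :=
    Real.sin_lt_sin_of_lt_of_le_pi_div_two (by linarith) (by push_cast; linarith)
      (by push_cast; linarith)
  have hlt : Real.cos (((a + 2 : ℕ) : ℝ) * t / 2) * Real.sin (b * t / 2) <
      Real.cos (((2 : ℕ) : ℝ) * t / 2) * Real.sin ((a + b : ℕ) * t / 2) :=
    mul_lt_mul'' c2 s2 c1.le s1.le
  have := div_lt_div_of_pos_left hc (mul_pos c1 s1) hlt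
  linarith

lemma secF_push (a b : ℕ) (ha : 1 ≤ a) (hb : 1 ≤ b) (hab : 3 ≤ a + b) (t : ℝ) (ht : 0 < t)
    (ht2 : (a + b) * t < Real.pi) (hF : secF a b t < 0) :
    ∃ t', t < t' ∧ (a + b) * t' < Real.pi ∧ secF a b t' < 0 := by
  have ha' : (1 : ℝ) ≤ a := by exact_mod_cast ha
  have hb' : (1 : ℝ) ≤ b := by exact_mod_cast hb
  have hab' : (3 : ℝ) ≤ a + b := by exact_mod_cast hab
  have hpi := Real.pi_pos
  have hat : 0 < a * t := by positivity
  have hbt : 0 < b * t := by positivity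
  have h3t : 3 * t ≤ (a + b) * t := by gcongr
  have hc : Real.cos t ≠ 0 := (Real.cos_pos_of_mem_Ioo ⟨by linarith, by linarith⟩).ne'
  have c1 : Real.cos (t / 2) ≠ 0 := (Real.cos_pos_of_mem_Ioo ⟨by linarith, by linarith⟩).ne'
  have ca : Real.cos (a * t / 2) ≠ 0 := (Real.cos_pos_of_mem_Ioo ⟨by linarith, by linarith⟩).ne'
  have sb : Real.sin (b * t / 2) ≠ 0 :=
    (Real.sin_pos_of_pos_of_lt_pi (by linarith) (by linarith)).ne'
  have hcont : ContinuousAt (secF a b) t := by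
    unfold secF
    fun_prop (disch := assumption)
  have hcont2 : ContinuousAt (fun t : ℝ => (a + b) * t) t := by fun_prop
  have e1 := hcont.eventually (gt_mem_nhds hF)
  have e2 := hcont2.eventually (gt_mem_nhds ht2)
  have e3 := ((e1.and e2).filter_mono (nhdsWithin_le_nhds (s := Set.Ioi t))).and
    self_mem_nhdsWithin
  obtain ⟨t', ⟨h1, h2⟩, h3⟩ := e3.exists
  exact ⟨t', h3, h2, h1⟩

lemma sum_two (n : ℕ) (P : Fin n → Prop) (f : ℕ → ℝ) (p q : ℕ) (hp : p < n) (hq : q < n)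
    (hpq : p ≠ q) (h : ∀ w : Fin n, P w ↔ w.val = p ∨ w.val = q) :
    (∑ w : Fin n, if P w then f w else 0) = f p + f q := by
  have : ∀ w : Fin n, (if P w then f w else 0) =
      (fun i : ℕ => (if i = p then f i else 0) + (if i = q then f i else 0)) w.val := by
    intro w
    have := h w
    by_cases h1 : w.val = p
    · rw [if_pos (this.2 (Or.inl h1))]
      simp [h1, hpq]
    · by_cases h2 : w.val = q
      · rw [if_pos (this.2 (Or.inr h2))]
        simp [h2, Ne.symm hpq]
      · rw [if_neg (by rw [this]; tauto)]
        simp [h1, h2]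
  rw [Finset.sum_congr rfl fun w _ => this w, Fin.sum_univ_eq_sum_range
    (fun i : ℕ => (if i = p then f i else 0) + (if i = q then f i else 0)),
    Finset.sum_add_distrib]
  simp [hp, hq]

lemma sum_three (n : ℕ) (P : Fin n → Prop) (f : ℕ → ℝ) (p q r : ℕ) (hp : p < n) (hq : q < n)
    (hr : r < n) (hpq : p ≠ q) (hpr : p ≠ r) (hqr : q ≠ r)
    (h : ∀ w : Fin n, P w ↔ w.val = p ∨ w.val = q ∨ w.val = r) :
    (∑ w : Fin n, if P w then f w else 0) = f p + f q + f r := by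
  have : ∀ w : Fin n, (if P w then f w else 0) =
      (fun i : ℕ => (if i = p then f i else 0) + (if i = q then f i else 0) +
        (if i = r then f i else 0)) w.val := by
    intro w
    have := h w
    by_cases h1 : w.val = p
    · rw [if_pos (this.2 (Or.inl h1))]
      simp [h1, hpq, hpr]
    · by_cases h2 : w.val = q
      · rw [if_pos (this.2 (Or.inr (Or.inl h2)))]
        simp [h2, Ne.symm hpq, hqr]
      · by_cases h3 : w.val = r
        · rw [if_pos (this.2 (Or.inr (Or.inr h3)))]
          simp [h3, Ne.symm hpr, Ne.symm hqr]
        · rw [if_neg (by rw [this]; tauto)]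
          simp [h1, h2, h3]
  rw [Finset.sum_congr rfl fun w _ => this w, Fin.sum_univ_eq_sum_range
    (fun i : ℕ => (if i = p then f i else 0) + (if i = q then f i else 0) +
      (if i = r then f i else 0)), Finset.sum_add_distrib,
    Finset.sum_add_distrib]
  simp [hp, hq, hr]

lemma theta_eigvec (b : ℕ) (hb : Odd b) (t : ℝ) (ht : 0 < t) (ht2 : (b + 2) * t < Real.pi)
    (hF : secF 2 b t = 0) :
    ∃ x : Fin (b + 3) → ℝ, x ≠ 0 ∧
      (signlessLaplacian (thetaG (b + 3))).mulVec x = (2 - 2 * Real.cos t) • x := by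
  have hb1 : 1 ≤ b := hb.pos
  have hpi := Real.pi_pos
  have hb' : (1 : ℝ) ≤ b := by exact_mod_cast hb1
  have hbt : 0 < b * t := by positivity
  have h3t : 3 * t ≤ (b + 2) * t := by gcongr; linarith
  have hc : 0 < Real.cos t := Real.cos_pos_of_mem_Ioo ⟨by linarith, by linarith⟩
  have c1 : 0 < Real.cos (t / 2) := Real.cos_pos_of_mem_Ioo ⟨by linarith, by linarith⟩
  have sb : 0 < Real.sin (b * t / 2) := Real.sin_pos_of_pos_of_lt_pi (by linarith) (by linarith)
  have main : Real.sin (b * t / 2) * 3 - 2 * (Real.sin (b * t / 2) / Real.cos t)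
      - Real.sin (b * t / 2 - t) = (2 - 2 * Real.cos t) * Real.sin (b * t / 2) := by
    unfold secF at hF
    rw [show ((2 : ℕ) : ℝ) * t / 2 = t by push_cast; ring] at hF
    have w := half3 t c1.ne'
    have h1 := Real.sin_sq_add_cos_sq t
    have hF2 : 2 * Real.sin t ^ 2 / Real.cos t * Real.sin (b * t / 2) =
        (1 - Real.cos t) * Real.sin (b * t / 2) + Real.cos (b * t / 2) * Real.sin t := by
      have e : Real.cos (b * t / 2) =
        Real.cos (b * t / 2) / Real.sin (b * t / 2) * Real.sin (b * t / 2) := by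
        rw [div_mul_cancel₀ _ sb.ne']
      rw [e, w]
      linear_combination (Real.sin t * Real.sin (b * t / 2)) * hF
    have h3 : 2 * Real.sin t ^ 2 / Real.cos t = 2 / Real.cos t - 2 * Real.cos t := by
      field_simp
      linear_combination h1
    rw [h3] at hF2
    rw [Real.sin_sub]
    linear_combination -hF2
  let X : ℕ → ℝ := fun i => if i < 2 then - (Real.sin (b * t / 2) / Real.cos t) else
    (-1) ^ i * Real.sin (b * t / 2 + 2 * t - i * t)
  have X0 : X 0 = - (Real.sin (b * t / 2) / Real.cos t) := by simp [X]
  have X1 : X 1 = - (Real.sin (b * t / 2) / Real.cos t) := by simp [X]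
  have Xi : ∀ i, 2 ≤ i → X i = (-1) ^ i * Real.sin (b * t / 2 + 2 * t - i * t) := by
    intro i hi
    simp only [X]
    rw [if_neg (by omega)]
  have X2 : X 2 = Real.sin (b * t / 2) := by
    rw [Xi 2 le_rfl]; norm_num
  have X3 : X 3 = - Real.sin (b * t / 2 - t) := by
    rw [Xi 3 (by omega)]
    rw [show b * t / 2 + 2 * t - (3 : ℕ) * t = b * t / 2 - t by push_cast; ring]
    norm_num
  have XN : X (b + 2) = Real.sin (b * t / 2) := by
    rw [Xi _ (by omega)]
    rw [show b * t / 2 + 2 * t - (b + 2 : ℕ) * t = - (b * t / 2) by push_cast; ring, Real.sin_neg,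
      pow_add, hb.neg_one_pow]
    norm_num
  have XN1 : X (b + 1) = - Real.sin (b * t / 2 - t) := by
    rw [Xi _ (by omega)]
    rw [show b * t / 2 + 2 * t - (b + 1 : ℕ) * t = - (b * t / 2 - t) by push_cast; ring,
      Real.sin_neg, pow_add, hb.neg_one_pow]
    norm_num
  refine ⟨fun v => X v.val, ?_, ?_⟩
  · intro h0
    have := congrFun h0 ⟨2, by omega⟩
    simp only [X2, Pi.zero_apply] at this
    linarith
  · funext v
    rw [sl_mulVec]
    simp only [Pi.smul_apply, smul_eq_mul]
    obtain ⟨v, hv⟩ := v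
    by_cases v0 : v = 0 ∨ v = 1
    · rw [sum_two (b + 3) _ (fun i => X v + X i) 2 (b + 2) (by omega) (by omega) (by omega)]
      · have hXv : X v = - (Real.sin (b * t / 2) / Real.cos t) := by
          rcases v0 with rfl | rfl <;> assumption
        rw [X2, XN, hXv]
        field_simp
        ring
      · intro w
        have := w.isLt
        simp only [thetaG, thetaJK, SimpleGraph.fromRel_adj, Fin.ne_iff_vne]
        omega
    by_cases v2 : v = 2
    · subst v2
      rw [sum_three (b + 3) _ (fun i => X 2 + X i) 0 1 3 (by omega) (by omega) (by omega)
        (by omega) (by omega) (by omega)]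
      · simp only [X0, X1, X2, X3]
        linear_combination main
      · intro w
        have := w.isLt
        simp only [thetaG, thetaJK, SimpleGraph.fromRel_adj, Fin.ne_iff_vne, true_or, and_true]
        omega
    by_cases vN : v = b + 2
    · subst vN
      rw [sum_three (b + 3) _ (fun i => X (b + 2) + X i) 0 1 (b + 1) (by omega) (by omega)
        (by omega) (by omega) (by omega) (by omega)]
      · simp only [X0, X1, XN, XN1]
        linear_combination main
      · intro w
        have := w.isLt
        simp only [thetaG, thetaJK, SimpleGraph.fromRel_adj, Fin.ne_iff_vne]
        omega
    · obtain ⟨u, rfl⟩ : ∃ u, v = u + 1 := ⟨v - 1, by omega⟩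
      rw [sum_two (b + 3) _ (fun i => X (u + 1) + X i) u (u + 2) (by omega) (by omega) (by omega)]
      · simp only [Xi u (by omega), Xi (u + 1) (by omega), Xi (u + 2) (by omega)]
        have e1 : (b : ℝ) * t / 2 + 2 * t - u * t =
          (b * t / 2 + 2 * t - (u + 1 : ℕ) * t) + t := by push_cast; ring
        have e2 : (b : ℝ) * t / 2 + 2 * t - (u + 2 : ℕ) * t =
          (b * t / 2 + 2 * t - (u + 1 : ℕ) * t) - t := by push_cast; ring
        rw [e1, e2]
        generalize (b : ℝ) * t / 2 + 2 * t - (u + 1 : ℕ) * t = y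
        rw [Real.sin_add, Real.sin_sub, pow_succ, pow_add]
        ring
      · intro w
        have := w.isLt
        simp only [thetaG, thetaJK, SimpleGraph.fromRel_adj, Fin.ne_iff_vne]
        omega

theorem stmt12 (n j k : ℕ) (hn : 4 ≤ n) (heven : Even n)
    (hj : 1 ≤ j) (hjk : j < k) (hk : k ≤ n - 1) :
    leastQEig (thetaG n) ≤ leastQEig (thetaJK n j k) ∧
      (leastQEig (thetaG n) = leastQEig (thetaJK n j k) ↔
        Nonempty (thetaJK n j k ≃g thetaG n)) := by
  obtain ⟨a, ha, ha2, han, ⟨e⟩⟩ := theta_canon n j k hn heven hj hjk hk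
  obtain ⟨e0⟩ : Nonempty (thetaG n ≃g thetaJK n 1 (2 + 1)) := by
    rw [theta_swap n 1]
    refine theta_rot n 2 (n - 1) 3 1 (n - 2) hn (by omega) (by omega) (by omega)
      (by omega) (by omega) ?_ ?_
    · split_ifs <;> omega
    · split_ifs <;> omega
  by_cases h2 : a = 2
  · subst h2
    have e' := e.trans e0.symm
    have := leastQEig_iso e'
    exact ⟨this.symm.le, fun _ => ⟨e'⟩, fun _ => this.symm⟩
  have hlt : leastQEig (thetaG n) < leastQEig (thetaJK n j k) := by
    obtain ⟨d, hd⟩ := heven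
    obtain ⟨c, hc⟩ := ha
    obtain ⟨a', rfl⟩ : ∃ a', a = a' + 2 := ⟨a - 2, by omega⟩
    obtain ⟨b, rfl⟩ : ∃ b, n = a' + b + 3 := ⟨n - a' - 3, by omega⟩
    have hbodd : Odd b := ⟨d - c - 1, by omega⟩
    have hb1 : 1 ≤ b := hbodd.pos
    have hodd : Odd (a' + b) := ⟨d - 2, by omega⟩
    obtain ⟨t, ht, ht2, hF⟩ := root_exists (a' + b) (by omega)
    have hF' := secF_lt a' b (by omega) hb1 t ht (by push_cast at ht2; linarith)
    rw [hF] at hF'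
    obtain ⟨t', htt, ht3, hF3⟩ := secF_push (a' + 2) b (by omega) hb1 (by omega) t ht
      (by push_cast at ht2 ⊢; linarith) hF'
    have low1 : ∀ μ ∈ {μ : ℝ | ∃ x : Fin (a' + b + 3) → ℝ, x ≠ 0 ∧
        (signlessLaplacian (thetaG (a' + b + 3))).mulVec x = μ • x}, 2 - 2 * Real.cos t ≤ μ := by
      intro μ hμ
      exact eig_lower' (a' + b + 3) 2 (a' + b) (by omega) even_two hodd le_rfl t ht
        (by push_cast at ht2 ⊢; linarith) hF.le μ (eig_sub e0 μ hμ)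
    have up : leastQEig (thetaG (a' + b + 3)) ≤ 2 - 2 * Real.cos t :=
      csInf_le ⟨_, low1⟩ (theta_eigvec (a' + b) hodd t ht ht2 hF)
    have low2 : 2 - 2 * Real.cos t' ≤ leastQEig (thetaJK (a' + b + 3) j k) := by
      refine le_csInf (eig_nonempty _) fun μ hμ => ?_
      exact eig_lower' (a' + b + 3) (a' + 2) b (by omega) ⟨c, hc⟩ hbodd (by omega) t'
        (ht.trans htt) ht3 hF3.le μ (eig_sub e μ hμ)
    have hcos : Real.cos t' < Real.cos t := by
      apply Real.cos_lt_cos_of_nonneg_of_le_pi ht.le _ htt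
      have h1 : (1 : ℝ) ≤ (a' + 2 : ℕ) + b := by exact_mod_cast (by omega : 1 ≤ a' + 2 + b)
      nlinarith
    linarith
  refine ⟨hlt.le, fun h => absurd h hlt.ne, fun ⟨e'⟩ => ?_⟩
  exact (leastQEig_iso e').symm
end

section
/- Let G be a nonbipartite θ-graph of odd order n ≥ 5. Then q(C_n) ≤ q(G), and if equality holds then G ≅ C_n or G ≅ H(i) for some 1 ≤ i ≤ (n-3)/2, where H(i) = C_n + v_i v_{n-i}. -/
open Matrix SimpleGraph
open scoped Classical

/-- A θ-graph: a 2-connected graph consisting of three pairwise internally disjoint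
paths with common initial and terminal vertices. -/
def IsThetaGraph {V : Type*} [Fintype V] (G : SimpleGraph V) : Prop :=
  TwoConnected G ∧ ∃ (a b : V) (_ : a ≠ b) (P₁ P₂ P₃ : G.Walk a b),
    P₁.IsPath ∧ P₂.IsPath ∧ P₃.IsPath ∧
    (∀ x, x ∈ P₁.support → x ∈ P₂.support → x = a ∨ x = b) ∧
    (∀ x, x ∈ P₁.support → x ∈ P₃.support → x = a ∨ x = b) ∧
    (∀ x, x ∈ P₂.support → x ∈ P₃.support → x = a ∨ x = b) ∧
    (∀ v : V, v ∈ P₁.support ∨ v ∈ P₂.support ∨ v ∈ P₃.support) ∧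
    (∀ e ∈ G.edgeSet, e ∈ P₁.edges ∨ e ∈ P₂.edges ∨ e ∈ P₃.edges)

theorem quad_eq {V : Type*} [Fintype V] (G : SimpleGraph V) (x : V → ℝ) :
    x ⬝ᵥ (signlessLaplacian G).mulVec x
      = ∑ e : Sym2 V, (((G.incMatrix ℝ)ᵀ *ᵥ x) e) ^ 2 := by
  have h : signlessLaplacian G = G.incMatrix ℝ * (G.incMatrix ℝ)ᵀ := by
    rw [incMatrix_mul_transpose]
    ext i j
    simp only [signlessLaplacian]
    by_cases hij : i = j
    · subst hij
      simp [Set.ncard_eq_toFinset_card', ← SimpleGraph.card_neighborFinset_eq_degree, SimpleGraph.neighborFinset]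
    · simp [hij]
  rw [h, ← Matrix.mulVec_mulVec, Matrix.dotProduct_mulVec, ← Matrix.mulVec_transpose]
  simp [dotProduct, sq]

theorem inc_apply {V : Type*} [Fintype V] (G : SimpleGraph V) (x : V → ℝ) {u v : V}
    (h : G.Adj u v) : ((G.incMatrix ℝ)ᵀ *ᵥ x) s(u, v) = x u + x v := by
  have hne := h.ne
  simp only [Matrix.mulVec, dotProduct, Matrix.transpose_apply, incMatrix_apply', 
    SimpleGraph.mk'_mem_incidenceSet_iff]
  have : ∀ i, (if G.Adj u v ∧ (i = u ∨ i = v) then (1:ℝ) else 0) * x i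
      = (if i = u then x i else 0) + (if i = v then x i else 0) := by
    intro i
    by_cases h1 : i = u
    · subst h1; simp [h, hne]
    · by_cases h2 : i = v
      · subst h2; simp [h1, h]
      · simp [h1, h2]
  simp [this, Finset.sum_add_distrib]

theorem le_leastQ {V : Type*} [Fintype V] [Nonempty V] (G : SimpleGraph V) (l : ℝ)
    (h : ∀ x : V → ℝ, l * ∑ v, x v ^ 2 ≤ ∑ e : Sym2 V, (((G.incMatrix ℝ)ᵀ *ᵥ x) e) ^ 2) :
    l ≤ leastQEig G := by
  have hH : (signlessLaplacian G).IsHermitian := by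
    ext i j
    simp only [Matrix.conjTranspose_apply, signlessLaplacian, star_trivial]
    by_cases hij : i = j
    · subst hij; rfl
    · simp [hij, Ne.symm hij, G.adj_comm]
  apply le_csInf
  · obtain ⟨i⟩ := ‹Nonempty V›
    refine ⟨hH.eigenvalues i, (hH.eigenvectorBasis i).ofLp, ?_, hH.mulVec_eigenvectorBasis i⟩
    intro h0
    have := hH.eigenvectorBasis.orthonormal.ne_zero i
    apply this
    ext j
    simpa using congrFun h0 j
  · rintro μ ⟨x, hx, he⟩
    have h1 := h x
    rw [← quad_eq, he] at h1
    have h2 : x ⬝ᵥ (μ • x) = μ * ∑ v, x v ^ 2 := by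
      simp only [dotProduct, sq, Pi.smul_apply, smul_eq_mul, Finset.mul_sum]
      exact Finset.sum_congr rfl (fun i _ => by ring)
    rw [h2] at h1
    have h3 : 0 < ∑ v, x v ^ 2 := by
      obtain ⟨v, hv⟩ := Function.ne_iff.mp hx
      apply Finset.sum_pos' (fun i _ => sq_nonneg _) ⟨v, Finset.mem_univ _, by 
        have : x v ≠ 0 := hv
        positivity⟩
    exact le_of_mul_le_mul_right h1 h3

theorem leastQ_le {V : Type*} [Fintype V] (G : SimpleGraph V) (l : ℝ) (x : V → ℝ) (hx : x ≠ 0)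
    (he : (signlessLaplacian G).mulVec x = l • x) : leastQEig G ≤ l := by
  refine csInf_le (⟨0, ?_⟩ : BddBelow _) ⟨x, hx, he⟩
  rintro μ ⟨x, hx, he⟩
  have h1 := quad_eq G x
  rw [he] at h1
  have h2 : x ⬝ᵥ (μ • x) = μ * ∑ v, x v ^ 2 := by
    simp only [dotProduct, sq, Pi.smul_apply, smul_eq_mul, Finset.mul_sum]
    exact Finset.sum_congr rfl (fun i _ => by ring)
  rw [h2] at h1
  have h3 : 0 < ∑ v, x v ^ 2 := by
    obtain ⟨v, hv⟩ := Function.ne_iff.mp hx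
    apply Finset.sum_pos' (fun i _ => sq_nonneg _) ⟨v, Finset.mem_univ _, by 
      have : x v ≠ 0 := hv
      positivity⟩
  have h4 : 0 ≤ ∑ e : Sym2 V, (((G.incMatrix ℝ)ᵀ *ᵥ x) e) ^ 2 :=
    Finset.sum_nonneg (fun i _ => sq_nonneg _)
  rw [← h1] at h4
  exact nonneg_of_mul_nonneg_left h4 h3

/-- the minimal energy of a path of length `l` with prescribed end values -/
noncomputable def FF (φ : ℝ) (l : ℕ) (x y : ℝ) : ℝ :=
  (1 - Real.cos φ) * (x ^ 2 + y ^ 2) +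
    Real.sin φ / Real.sin (l * φ) * (Real.cos (l * φ) * (x ^ 2 + y ^ 2) - 2 * x * y)

theorem FF_step (φ : ℝ) (l : ℕ) (x y w : ℝ) (h1 : 0 < Real.sin (l * φ))
    (h2 : 0 < Real.sin ((l + 1 : ℕ) * φ)) :
    FF φ (l + 1) x (-w) ≤ FF φ l y w + (x + y) ^ 2 - (2 - 2 * Real.cos φ) * y ^ 2 := by
  have e1 : ((l + 1 : ℕ) : ℝ) * φ = l * φ + φ := by push_cast; ring
  rw [e1] at h2
  unfold FF
  rw [e1]
  have hs : Real.sin (l * φ + φ) = Real.sin (l * φ) * Real.cos φ + Real.cos (l * φ) * Real.sin φ :=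
    Real.sin_add _ _
  rw [Real.cos_add]
  have p1 := Real.sin_sq_add_cos_sq φ
  have p2 := Real.sin_sq_add_cos_sq (l * φ)
  rw [hs] at h2 ⊢
  generalize Real.sin (l * φ) = S at *
  generalize Real.cos (l * φ) = C at *
  generalize Real.sin φ = s at *
  generalize Real.cos φ = k at *
  rw [← sub_nonneg]
  set S' := S * k + C * s with hS'
  have : (1 - k) * (y ^ 2 + w ^ 2) + s / S * (C * (y ^ 2 + w ^ 2) - 2 * y * w) + (x + y) ^ 2 -
      (2 - 2 * k) * y ^ 2 - ((1 - k) * (x ^ 2 + (-w) ^ 2) +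
      s / S' * ((C * k - S * s) * (x ^ 2 + (-w) ^ 2) - 2 * x * -w))
      = S' / S * (y + (S * x - s * w) / S') ^ 2 := by
    have hS := h1.ne'
    have hS2 := h2.ne'
    field_simp
    rw [hS']
    have q1 : s ^ 2 = 1 - k ^ 2 := by linarith
    have q2 : S ^ 2 = 1 - C ^ 2 := by linarith
    grind
  rw [this]
  positivity

theorem walk_bound {V : Type*} [Fintype V] (G : SimpleGraph V) (x : V → ℝ) (φ : ℝ) (h0 : 0 < φ)
    {u v : V} (w : G.Walk u v) : 1 ≤ w.length → w.length * φ < Real.pi →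
    FF φ w.length (x u) ((-1) ^ w.length * x v) ≤
      (w.edges.map (fun e => (((G.incMatrix ℝ)ᵀ *ᵥ x) e) ^ 2)).sum
      - (2 - 2 * Real.cos φ) * (w.support.map (fun a => x a ^ 2)).sum
      + (2 - 2 * Real.cos φ) * (x u ^ 2 + x v ^ 2) := by
  induction w with
  | nil => simp
  | @cons a b c hab q ih =>
    intro _ hl
    by_cases hq : q.length = 0
    · cases q with
      | nil =>
        simp only [Walk.length_cons, Walk.length_nil, zero_add, Nat.cast_one, one_mul] at hl
        have : 0 < Real.sin φ := Real.sin_pos_of_pos_of_lt_pi h0 (by simpa using hl)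
        simp only [Walk.length_cons, Walk.length_nil, FF, Walk.edges_cons, Walk.edges_nil,
          Walk.support_cons, Walk.support_nil, List.map_cons, List.map_nil, List.sum_cons,
          List.sum_nil, inc_apply G x hab]
        simp [this.ne']
        ring_nf
        rfl
      | cons _ _ => simp at hq
    · have hl2 : (q.length : ℝ) * φ < Real.pi := by
        refine lt_trans ?_ hl
        simp only [Walk.length_cons]
        push_cast
        nlinarith
      have := ih (by omega) hl2
      have h3 := FF_step φ q.length (x a) (x b) ((-1) ^ q.length * x c)
        (Real.sin_pos_of_pos_of_lt_pi (mul_pos (by exact_mod_cast Nat.pos_of_ne_zero hq) h0) hl2)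
        (Real.sin_pos_of_pos_of_lt_pi (mul_pos (by positivity) h0) (by simpa using hl))
      simp only [Walk.length_cons, Walk.edges_cons,
          Walk.support_cons, List.map_cons, List.sum_cons, inc_apply G x hab]
      have e : (-1 : ℝ) ^ (q.length + 1) * x c = -((-1) ^ q.length * x c) := by ring
      rw [e]
      nlinarith

theorem tan_aux {t : ℝ} (h0 : 0 < t) (h1 : t < Real.pi) :
    (1 - Real.cos t) / Real.sin t = Real.tan (t / 2) ∧
    (1 + Real.cos t) / Real.sin t = 1 / Real.tan (t / 2) := by
  have hs : 0 < Real.sin (t / 2) := Real.sin_pos_of_pos_of_lt_pi (by linarith) (by linarith)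
  have hc : 0 < Real.cos (t / 2) := Real.cos_pos_of_mem_Ioo ⟨by linarith, by linarith⟩
  have e1 : Real.sin t = 2 * Real.sin (t / 2) * Real.cos (t / 2) := by
    rw [← Real.sin_two_mul]; congr 1; ring
  have e2 : Real.cos t = 2 * Real.cos (t / 2) ^ 2 - 1 := by
    rw [← Real.cos_two_mul]; congr 1; ring
  have p := Real.sin_sq_add_cos_sq (t / 2)
  rw [e1, e2, Real.tan_eq_sin_div_cos]
  constructor
  · field_simp
    nlinarith
  · field_simp
    ring

theorem tan_major {p r θ : ℝ} (h0 : 0 < θ) (hp : 1 < p) (hr : 1 < r)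
    (h : (p + r - 1) * θ < Real.pi / 2) :
    Real.tan (p * θ) + Real.tan (r * θ) < Real.tan ((p + r - 1) * θ) + Real.tan θ := by
  have hpθ : p * θ < (p + r - 1) * θ := by nlinarith
  have hrθ : r * θ < (p + r - 1) * θ := by nlinarith
  have hθ1 : θ < p * θ := by nlinarith
  have hθ2 : θ < r * θ := by nlinarith
  have c1 : 0 < Real.cos (p * θ) := Real.cos_pos_of_mem_Ioo ⟨by linarith, by linarith⟩
  have c2 : 0 < Real.cos (r * θ) := Real.cos_pos_of_mem_Ioo ⟨by linarith, by linarith⟩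
  have c3 : 0 < Real.cos ((p + r - 1) * θ) := Real.cos_pos_of_mem_Ioo ⟨by linarith, by linarith⟩
  have c4 : 0 < Real.cos θ := Real.cos_pos_of_mem_Ioo ⟨by linarith, by linarith⟩
  have s0 : 0 < Real.sin ((r - 1) * θ) :=
    Real.sin_pos_of_pos_of_lt_pi (by nlinarith) (by nlinarith)
  have e1 : Real.tan ((p + r - 1) * θ) - Real.tan (p * θ)
      = Real.sin ((r - 1) * θ) / (Real.cos ((p + r - 1) * θ) * Real.cos (p * θ)) := by
    have : (r - 1) * θ = (p + r - 1) * θ - p * θ := by ring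
    rw [this, Real.sin_sub, Real.tan_eq_sin_div_cos, Real.tan_eq_sin_div_cos]
    field_simp
  have e2 : Real.tan (r * θ) - Real.tan θ
      = Real.sin ((r - 1) * θ) / (Real.cos (r * θ) * Real.cos θ) := by
    have : (r - 1) * θ = r * θ - θ := by ring
    rw [this, Real.sin_sub, Real.tan_eq_sin_div_cos, Real.tan_eq_sin_div_cos]
    field_simp
  have key : Real.cos ((p + r - 1) * θ) * Real.cos (p * θ) < Real.cos (r * θ) * Real.cos θ := by
    have k1 := Real.cos_add ((p + r - 1) * θ) (p * θ)
    have k2 := Real.cos_sub ((p + r - 1) * θ) (p * θ)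
    have k3 := Real.cos_add (r * θ) θ
    have k4 := Real.cos_sub (r * θ) θ
    have k5 : (p + r - 1) * θ - p * θ = r * θ - θ := by ring
    rw [k5] at k2
    have k6 : Real.cos ((p + r - 1) * θ + p * θ) < Real.cos (r * θ + θ) := by
      apply Real.cos_lt_cos_of_nonneg_of_le_pi <;> nlinarith
    linarith
  have : Real.sin ((r - 1) * θ) / (Real.cos (r * θ) * Real.cos θ) <
      Real.sin ((r - 1) * θ) / (Real.cos ((p + r - 1) * θ) * Real.cos (p * θ)) := by
    apply div_lt_div_of_pos_left s0 (by positivity) key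
  linarith

noncomputable def AA (p r s : ℕ) (φ : ℝ) : ℝ := (1 - Real.cos φ) / Real.sin φ
  + Real.cos (p * φ) / Real.sin (p * φ) + Real.cos (r * φ) / Real.sin (r * φ)
  + Real.cos (s * φ) / Real.sin (s * φ)

noncomputable def BB (p r s : ℕ) (φ : ℝ) : ℝ :=
  1 / Real.sin (p * φ) + 1 / Real.sin (r * φ) - 1 / Real.sin (s * φ)

theorem AB_pos (n p r s : ℕ) (hn : 1 ≤ n) (h : p + r + s = n + 1) (hp : 2 ≤ p) (hr : 2 ≤ r)
    (hs : 1 ≤ s) : 0 < AA p r s (Real.pi / n) - BB p r s (Real.pi / n) ∧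
      0 < AA p r s (Real.pi / n) + BB p r s (Real.pi / n) := by
  have hn' : (0:ℝ) < n := by exact_mod_cast hn
  have hpi := Real.pi_pos
  set φ := Real.pi / n with hφ
  have h0 : 0 < φ := by positivity
  have hnφ : n * φ = Real.pi := by rw [hφ]; field_simp
  have h' : (p:ℝ) + r + s = n + 1 := by exact_mod_cast h
  have hp' : (2:ℝ) ≤ p := by exact_mod_cast hp
  have hr' : (2:ℝ) ≤ r := by exact_mod_cast hr
  have hs' : (1:ℝ) ≤ s := by exact_mod_cast hs
  have b1 : φ < Real.pi := by
    have := mul_lt_mul_of_pos_right (show (1:ℝ) < n by linarith) h0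
    linarith
  have bp : p * φ < Real.pi := hnφ ▸ mul_lt_mul_of_pos_right (by linarith) h0
  have br : r * φ < Real.pi := hnφ ▸ mul_lt_mul_of_pos_right (by linarith) h0
  have bs : s * φ < Real.pi := hnφ ▸ mul_lt_mul_of_pos_right (by linarith) h0
  have p1 : 0 < p * φ := by positivity
  have r1 : 0 < r * φ := by positivity
  have s1 : 0 < s * φ := by positivity
  obtain ⟨t1, -⟩ := tan_aux h0 b1
  obtain ⟨tp, tp'⟩ := tan_aux p1 bp
  obtain ⟨tr, tr'⟩ := tan_aux r1 br
  obtain ⟨ts, ts'⟩ := tan_aux s1 bs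
  have es : s * φ / 2 = Real.pi / 2 - (p + r - 1) * (φ / 2) := by
    have : (s:ℝ) = n + 1 - p - r := by linarith
    rw [this]
    linear_combination hnφ / 2
  have ets : Real.tan (s * φ / 2) = (Real.tan ((p + r - 1) * (φ / 2)))⁻¹ := by
    rw [es, Real.tan_pi_div_two_sub]
  have hlt : ((p:ℝ) + r - 1) * (φ / 2) < Real.pi / 2 := by linarith
  have mj := tan_major (p := p) (r := r) (θ := φ / 2) (by linarith) (by linarith) (by linarith) hlt
  have ep : (p : ℝ) * φ / 2 = p * (φ / 2) := by ring
  have er : (r : ℝ) * φ / 2 = r * (φ / 2) := by ring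
  rw [ep] at tp tp'
  rw [er] at tr tr'
  rw [ets] at ts ts'
  have tpos : ∀ y : ℝ, 0 < y → y < Real.pi / 2 → 0 < Real.tan y := fun y a b =>
    Real.tan_pos_of_pos_of_lt_pi_div_two a b
  have q1 := tpos (φ / 2) (by linarith) (by linarith)
  have q2 := tpos (r * (φ / 2)) (by linarith) (by linarith)
  have q3 := tpos (p * (φ / 2)) (by linarith) (by linarith)
  have q4 : Real.tan (p * (φ / 2)) < Real.tan ((p + r - 1) * (φ / 2)) := by
    apply Real.tan_lt_tan_of_lt_of_lt_pi_div_two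
    · linarith
    · exact hlt
    · exact mul_lt_mul_of_pos_right (by linarith) (by linarith)
  have q5 : (Real.tan ((p + r - 1) * (φ / 2)))⁻¹ < (Real.tan (p * (φ / 2)))⁻¹ := by
    apply inv_strictAnti₀ q3 q4
  have q6 : 0 < 1 / Real.tan (r * (φ / 2)) := by positivity
  simp only [one_div] at q6
  simp only [sub_div, add_div, one_div, inv_inv] at t1 tp tp' tr tr' ts ts'
  simp only [AA, BB, sub_div, one_div]
  constructor <;> linarith

theorem AB_cont (n p r s : ℕ) (hn : 1 ≤ n) (h : p + r + s = n + 1) (hp : 2 ≤ p) (hr : 2 ≤ r)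
    (hs : 1 ≤ s) : ∃ φ : ℝ, Real.pi / n < φ ∧ φ < Real.pi ∧ p * φ < Real.pi ∧ r * φ < Real.pi ∧
      s * φ < Real.pi ∧ 0 < AA p r s φ - BB p r s φ ∧ 0 < AA p r s φ + BB p r s φ := by
  obtain ⟨hA, hB⟩ := AB_pos n p r s hn h hp hr hs
  have hn' : (0:ℝ) < n := by exact_mod_cast hn
  have hpi := Real.pi_pos
  have h0 : 0 < Real.pi / n := by positivity
  have hnφ : n * (Real.pi / n) = Real.pi := by field_simp
  generalize Real.pi / n = φ at *
  have h' : (p:ℝ) + r + s = n + 1 := by exact_mod_cast h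
  have hp' : (2:ℝ) ≤ p := by exact_mod_cast hp
  have hr' : (2:ℝ) ≤ r := by exact_mod_cast hr
  have hs' : (1:ℝ) ≤ s := by exact_mod_cast hs
  have b1 : φ < Real.pi := by
    have := mul_lt_mul_of_pos_right (show (1:ℝ) < n by linarith) h0
    linarith
  have bp : p * φ < Real.pi := hnφ ▸ mul_lt_mul_of_pos_right (by linarith) h0
  have br : r * φ < Real.pi := hnφ ▸ mul_lt_mul_of_pos_right (by linarith) h0
  have bs : s * φ < Real.pi := hnφ ▸ mul_lt_mul_of_pos_right (by linarith) h0
  have n1 := (Real.sin_pos_of_pos_of_lt_pi h0 b1).ne'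
  have np := (Real.sin_pos_of_pos_of_lt_pi (show 0 < p * φ by positivity) bp).ne'
  have nr := (Real.sin_pos_of_pos_of_lt_pi (show 0 < r * φ by positivity) br).ne'
  have ns := (Real.sin_pos_of_pos_of_lt_pi (show 0 < s * φ by positivity) bs).ne'
  have cA : ContinuousAt (AA p r s) φ := by
    unfold AA
    fun_prop (disch := assumption)
  have cB : ContinuousAt (BB p r s) φ := by
    unfold BB
    fun_prop (disch := assumption)
  have ev := ((cA.sub cB).tendsto.eventually (lt_mem_nhds hA)).and (((cA.add cB).tendsto.eventually (lt_mem_nhds hB)).and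
    ((eventually_lt_nhds b1).and
    ((((show ContinuousAt (fun y : ℝ => p * y) φ by fun_prop).tendsto.eventually (gt_mem_nhds bp))).and
    ((((show ContinuousAt (fun y : ℝ => r * y) φ by fun_prop).tendsto.eventually (gt_mem_nhds br))).and
    (((show ContinuousAt (fun y : ℝ => s * y) φ by fun_prop).tendsto.eventually (gt_mem_nhds bs)))))))
  have ev2 := (ev.filter_mono (nhdsWithin_le_nhds (s := Set.Ioi φ))).and self_mem_nhdsWithin
  obtain ⟨y, ⟨a1, a2, a3, a4, a5, a6⟩, a7⟩ := ev2.exists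
  exact ⟨y, a7, a3, a4, a5, a6, a1, a2⟩

theorem FF_three (p r s : ℕ) (φ x y : ℝ) (h0 : 0 < Real.sin φ)
    (hA : 0 < AA p r s φ - BB p r s φ) (hB : 0 < AA p r s φ + BB p r s φ) :
    2 * (1 - Real.cos φ) * (x ^ 2 + y ^ 2) ≤ FF φ p x (-y) + FF φ r x (-y) + FF φ s x y := by
  have e : FF φ p x (-y) + FF φ r x (-y) + FF φ s x y - 2 * (1 - Real.cos φ) * (x ^ 2 + y ^ 2)
      = Real.sin φ * ((AA p r s φ - BB p r s φ) * (x - y) ^ 2 / 2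
        + (AA p r s φ + BB p r s φ) * (x + y) ^ 2 / 2) := by
    unfold FF AA BB
    have : (1 - Real.cos φ) = Real.sin φ * ((1 - Real.cos φ) / Real.sin φ) := by field_simp
    generalize (1 - Real.cos φ) / Real.sin φ = z at *
    rw [this]
    ring
  have : 0 ≤ Real.sin φ * ((AA p r s φ - BB p r s φ) * (x - y) ^ 2 / 2
        + (AA p r s φ + BB p r s φ) * (x + y) ^ 2 / 2) := by positivity
  linarith

theorem FF_two (r s : ℕ) (φ x y : ℝ) (h : r * φ + s * φ = Real.pi) :
    FF φ r x (-y) + FF φ s x y = 2 * (1 - Real.cos φ) * (x ^ 2 + y ^ 2) := by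
  have : r * φ = Real.pi - s * φ := by linarith
  unfold FF
  rw [this, Real.sin_pi_sub, Real.cos_pi_sub]
  ring

theorem cycle_le (n : ℕ) (hn : 5 ≤ n) (hodd : Odd n) :
    leastQEig (cycleG n) ≤ 2 - 2 * Real.cos (Real.pi / n) := by
  have hn' : (0:ℝ) < n := by exact_mod_cast (by omega : 0 < n)
  set φ := Real.pi / n with hφ
  have hnφ : n * φ = Real.pi := by rw [hφ]; field_simp
  let X : ℕ → ℝ := fun k => (-1) ^ k * Real.cos (k * φ)
  have hX0 : X 0 = 1 := by simp [X]
  have hXn : X n = 1 := by simp [X, hnφ, hodd.neg_one_pow]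
  have hXs : ∀ k, X (k + 2) = - 2 * Real.cos φ * X (k + 1) - X k := by
    intro k
    simp only [X]
    have e1 : ((k + 2 : ℕ) : ℝ) * φ = ((k + 1 : ℕ) : ℝ) * φ + φ := by push_cast; ring
    have e2 : ((k : ℕ) : ℝ) * φ = ((k + 1 : ℕ) : ℝ) * φ - φ := by push_cast; ring
    rw [e1, e2, Real.cos_add, Real.cos_sub]
    ring
  have hX1 : X (n + 1) = X 1 := by
    simp only [X]
    have : ((n + 1 : ℕ) : ℝ) * φ = φ + Real.pi := by push_cast; linarith
    rw [this, Real.cos_add_pi, pow_succ, hodd.neg_one_pow]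
    simp
  apply leastQ_le _ _ (fun k : Fin n => X k)
  · intro h
    have := congrFun h ⟨0, by omega⟩
    simp [hX0] at this
  · funext k
    let sc : Fin n := ⟨(k.val + 1) % n, Nat.mod_lt _ (by omega)⟩
    let pr : Fin n := ⟨(k.val + (n - 1)) % n, Nat.mod_lt _ (by omega)⟩
    have hk := k.2
    have hsc : sc.val = if k.val + 1 = n then 0 else k.val + 1 := by
      simp only [sc]
      split_ifs with hh
      · rw [hh]; simp
      · exact Nat.mod_eq_of_lt (by omega)
    have hpr : pr.val = if k.val = 0 then n - 1 else k.val - 1 := by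
      simp only [pr]
      split_ifs with hh
      · rw [hh, zero_add]; exact Nat.mod_eq_of_lt (by omega)
      · have : k.val + (n - 1) = (k.val - 1) + n := by omega
        rw [this, Nat.add_mod_right]
        exact Nat.mod_eq_of_lt (by omega)
    have hne : sc ≠ pr := by
      intro hh
      have := congrArg Fin.val hh
      rw [hsc, hpr] at this
      split_ifs at this <;> omega
    have hadj : ∀ j, (cycleG n).Adj k j ↔ j = sc ∨ j = pr := by
      intro j
      have hj := j.2
      have m1 : ∀ a < n, (a + 1) % n = if a + 1 = n then 0 else a + 1 := by
        intro a ha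
        split_ifs with hh
        · rw [hh]; simp
        · exact Nat.mod_eq_of_lt (by omega)
      simp only [cycleG, fromRel_adj, ne_eq, Fin.ext_iff, hsc, hpr, m1 _ hk, m1 _ hj]
      split_ifs <;> omega
    have hnb : (cycleG n).neighborSet k = {sc, pr} := by
      ext j; simp [hadj]
    have hdeg : ((cycleG n).neighborSet k).ncard = 2 := by
      rw [hnb, Set.ncard_pair hne]
    have hsum : (signlessLaplacian (cycleG n) *ᵥ fun k : Fin n => X k) k
        = 2 * X k + (X sc + X pr) := by
      simp only [Matrix.mulVec, dotProduct, signlessLaplacian, add_mul, Finset.sum_add_distrib,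
        hdeg, hadj]
      congr 1
      · simp
      · have : ∀ j : Fin n, (if j = sc ∨ j = pr then (1:ℝ) else 0) * X j
            = (if j = sc then X j else 0) + (if j = pr then X j else 0) := by
          intro j
          by_cases h1 : j = sc
          · subst h1; simp [hne]
          · by_cases h2 : j = pr
            · subst h2; simp [h1]
            · simp [h1, h2]
        simp [this, Finset.sum_add_distrib]
    rw [hsum]
    simp only [Pi.smul_apply, smul_eq_mul]
    have hs' : X sc = X (k + 1) := by
      rw [hsc]; split_ifs with hh
      · rw [hh, hXn, hX0]
      · rfl
    have hp' : X (k + 1) + X pr = - 2 * Real.cos φ * X k := by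
      rw [hpr]; split_ifs with hh
      · rw [hh]
        have := hXs (n - 1)
        rw [show n - 1 + 2 = n + 1 by omega, show n - 1 + 1 = n by omega, hXn, hX1] at this
        rw [hX0, zero_add]
        linarith
      · obtain ⟨m, hm⟩ : ∃ m, k.val = m + 1 := ⟨k.val - 1, by omega⟩
        rw [hm]
        have := hXs m
        simp only [Nat.add_sub_cancel]
        linarith
    rw [hs', hp']
    ring

structure Th {V : Type*} (G : SimpleGraph V) (a b : V) (P Q R : G.Walk a b) : Prop where
  ne : a ≠ b
  pP : P.IsPath
  pQ : Q.IsPath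
  pR : R.IsPath
  dPQ : ∀ x, x ∈ P.support → x ∈ Q.support → x = a ∨ x = b
  dPR : ∀ x, x ∈ P.support → x ∈ R.support → x = a ∨ x = b
  dQR : ∀ x, x ∈ Q.support → x ∈ R.support → x = a ∨ x = b
  cov : ∀ v : V, v ∈ P.support ∨ v ∈ Q.support ∨ v ∈ R.support
  edg : ∀ e ∈ G.edgeSet, e ∈ P.edges ∨ e ∈ Q.edges ∨ e ∈ R.edges

theorem Th.rot {V : Type*} {G : SimpleGraph V} {a b : V} {P Q R : G.Walk a b}
    (h : Th G a b P Q R) : Th G a b Q R P :=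
  ⟨h.ne, h.pQ, h.pR, h.pP, h.dQR, fun x a b => h.dPQ x b a, fun x a b => h.dPR x b a,
    fun v => by have := h.cov v; tauto, fun e he => by have := h.edg e he; tauto⟩

theorem Th.swap {V : Type*} {G : SimpleGraph V} {a b : V} {P Q R : G.Walk a b}
    (h : Th G a b P Q R) : Th G a b R Q P :=
  ⟨h.ne, h.pR, h.pQ, h.pP, fun x a b => h.dQR x b a, fun x a b => h.dPR x b a,
    fun x a b => h.dPQ x b a,
    fun v => by have := h.cov v; tauto, fun e he => by have := h.edg e he; tauto⟩

theorem sum_support {V : Type*} [Fintype V] {G : SimpleGraph V} {a b : V} (P : G.Walk a b)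
    (hP : P.IsPath) (g : V → ℝ) :
    (P.support.map g).sum = ∑ v, if v ∈ P.support then g v else 0 := by
  rw [← List.sum_toFinset g hP.support_nodup, ← Finset.sum_filter]
  congr 1
  ext v; simp

theorem Th.sum {V : Type*} [Fintype V] {G : SimpleGraph V} {a b : V} {P Q R : G.Walk a b}
    (h : Th G a b P Q R) (g : V → ℝ) :
    (P.support.map g).sum + (Q.support.map g).sum + (R.support.map g).sum
      = ∑ v, g v + 2 * (g a + g b) := by
  rw [sum_support P h.pP, sum_support Q h.pQ, sum_support R h.pR, ← Finset.sum_add_distrib,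
    ← Finset.sum_add_distrib]
  have : ∀ v, ((if v ∈ P.support then g v else 0) + (if v ∈ Q.support then g v else 0))
      + (if v ∈ R.support then g v else 0)
      = g v + 2 * ((if v = a then g v else 0) + (if v = b then g v else 0)) := by
    intro v
    by_cases h1 : v = a
    · subst h1
      simp [h.ne]; ring
    · by_cases h2 : v = b
      · subst h2
        simp [h1]; ring
      · have a1 := h.dPQ v
        have a2 := h.dPR v
        have a3 := h.dQR v
        have a4 := h.cov v
        simp only [h1, h2, or_self] at a1 a2 a3
        simp only [h1, h2, if_false]
        by_cases b1 : v ∈ P.support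
        · have b2 : v ∉ Q.support := a1 b1
          have b3 : v ∉ R.support := a2 b1
          simp [b1, b2, b3]
        · by_cases b2 : v ∈ Q.support
          · have b3 : v ∉ R.support := a3 b2
            simp [b1, b2, b3]
          · have b3 : v ∈ R.support := by tauto
            simp [b1, b2, b3]
  simp only [this]
  rw [Finset.sum_add_distrib, ← Finset.mul_sum, Finset.sum_add_distrib]
  simp

theorem Th.card {V : Type*} [Fintype V] {G : SimpleGraph V} {a b : V} {P Q R : G.Walk a b}
    (h : Th G a b P Q R) : P.length + Q.length + R.length = Fintype.card V + 1 := by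
  have := h.sum (fun _ => 1)
  simp at this
  have h2 : ((P.length + 1 + (Q.length + 1) + (R.length + 1) : ℕ) : ℝ)
    = ((Fintype.card V + 4 : ℕ) : ℝ) := by push_cast; linarith
  have h3 := Nat.cast_injective h2
  omega

theorem edge_len {V : Type*} {G : SimpleGraph V} {a b : V} (P : G.Walk a b)
    (hP : P.IsPath) (h : s(a, b) ∈ P.edges) : P.length = 1 := by
  cases P with
  | nil => simp at h
  | @cons _ c _ hac q =>
    rw [Walk.cons_isPath_iff] at hP
    rw [Walk.edges_cons, List.mem_cons] at h
    rcases h with h | h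
    · have : b = c := by
        rw [Sym2.eq_iff] at h
        rcases h with h | h
        · exact h.2
        · exact absurd h.1 hac.ne
      subst this
      have := (Walk.isPath_iff_nil.mp hP.1).eq_nil
      simp [this]
    · exact absurd (Walk.fst_mem_support_of_mem_edges _ h) hP.2

theorem edges_disj {V : Type*} {G : SimpleGraph V} {a b : V} (P Q : G.Walk a b)
    (hP : P.IsPath) (hQ : Q.IsPath) (d : ∀ x, x ∈ P.support → x ∈ Q.support → x = a ∨ x = b)
    (hl : P.length ≠ 1) : List.Disjoint P.edges Q.edges := by
  intro e h1 h2
  induction e with | _ u v =>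
  have hadj : G.Adj u v := Walk.adj_of_mem_edges _ h1
  have hu := d u (Walk.fst_mem_support_of_mem_edges _ h1) (Walk.fst_mem_support_of_mem_edges _ h2)
  have hv := d v (Walk.snd_mem_support_of_mem_edges _ h1) (Walk.snd_mem_support_of_mem_edges _ h2)
  have hne := hadj.ne
  have he : s(u, v) = s(a, b) := by
    rw [Sym2.eq_iff]
    rcases hu with hu | hu <;> rcases hv with hv | hv
    · exact absurd (hu.trans hv.symm) hne
    · exact Or.inl ⟨hu, hv⟩
    · exact Or.inr ⟨hu, hv⟩
    · exact absurd (hu.trans hv.symm) hne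
  rw [he] at h1
  exact hl (edge_len P hP h1)

theorem list_le {α : Type*} [Fintype α] (L : List α) (hL : L.Nodup) (f : α → ℝ) (hf : ∀ a, 0 ≤ f a) :
    (L.map f).sum ≤ ∑ a, f a := by
  rw [← List.sum_toFinset f hL]
  exact Finset.sum_le_sum_of_subset_of_nonneg (Finset.subset_univ _) (fun i _ _ => hf i)

theorem bound_two {V : Type*} [Fintype V] {G : SimpleGraph V} {a b : V} {P Q R : G.Walk a b}
    (h : Th G a b P Q R) (n : ℕ) (hcard : Fintype.card V = n) (hP : P.length = 1)
    (hQ : Even Q.length) (hR : Odd R.length) :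
    2 - 2 * Real.cos (Real.pi / n) ≤ leastQEig G := by
  haveI : Nonempty V := ⟨a⟩
  have hc := h.card
  have hn0 : 0 < n := hcard ▸ Fintype.card_pos
  have hn' : (0:ℝ) < n := by exact_mod_cast hn0
  have hpi := Real.pi_pos
  have h0 : 0 < Real.pi / n := by positivity
  have hnφ : n * (Real.pi / n) = Real.pi := by field_simp
  generalize Real.pi / n = φ at *
  have hQ0 : 1 ≤ Q.length := by
    by_contra hh
    exact h.ne (Walk.eq_of_length_eq_zero (p := Q) (by omega))
  have hQ2 : 2 ≤ Q.length := by rcases hQ with ⟨k, hk⟩; omega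
  have hR1 : 1 ≤ R.length := hR.pos
  have hQR : Q.length + R.length = n := by omega
  have hQR' : (R.length : ℝ) + Q.length = n := by exact_mod_cast (by omega)
  have hQ1' : (1:ℝ) ≤ Q.length := by exact_mod_cast hQ0
  have hR1' : (1:ℝ) ≤ R.length := by exact_mod_cast hR1
  apply le_leastQ
  intro x
  have bQ := walk_bound G x φ h0 Q hQ0 (hnφ ▸ mul_lt_mul_of_pos_right (by linarith) h0)
  have bR := walk_bound G x φ h0 R hR1 (hnφ ▸ mul_lt_mul_of_pos_right (by linarith) h0)
  rw [hQ.neg_one_pow, one_mul] at bQ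
  rw [hR.neg_one_pow, neg_one_mul] at bR
  have e := FF_two R.length Q.length φ (x a) (x b) (by rw [← add_mul, hQR', hnφ])
  have nd : (Q.edges ++ R.edges).Nodup :=
    List.Nodup.append h.pQ.isTrail.edges_nodup h.pR.isTrail.edges_nodup
      (edges_disj Q R h.pQ h.pR h.dQR (by omega))
  have le := list_le _ nd (fun e => (((G.incMatrix ℝ)ᵀ *ᵥ x) e) ^ 2) (fun _ => sq_nonneg _)
  rw [List.map_append, List.sum_append] at le
  have sm := h.sum (fun v => x v ^ 2)
  have sP : (P.support.map (fun v => x v ^ 2)).sum = x a ^ 2 + x b ^ 2 := by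
    cases P with
    | nil => simp at hP
    | cons _ q => cases q with
      | nil => simp
      | cons _ _ => simp at hP
  rw [sP] at sm
  have sm2 : ∑ v, x v ^ 2 = (Q.support.map (fun v => x v ^ 2)).sum
    + (R.support.map (fun v => x v ^ 2)).sum - (x a ^ 2 + x b ^ 2) := by linarith
  rw [sm2]
  linarith

theorem bound_three {V : Type*} [Fintype V] {G : SimpleGraph V} {a b : V} {P Q R : G.Walk a b}
    (h : Th G a b P Q R) (n : ℕ) (hcard : Fintype.card V = n) (hP : Odd P.length)
    (hQ : Even Q.length) (hR : Odd R.length) (hP1 : P.length ≠ 1) (hR1 : R.length ≠ 1) :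
    2 - 2 * Real.cos (Real.pi / n) < leastQEig G := by
  haveI : Nonempty V := ⟨a⟩
  have hc := h.card
  have hn0 : 0 < n := hcard ▸ Fintype.card_pos
  have hn' : (0:ℝ) < n := by exact_mod_cast hn0
  have hpi := Real.pi_pos
  have h00 : 0 < Real.pi / n := by positivity
  have hQ0 : 1 ≤ Q.length := by
    by_contra hh
    exact h.ne (Walk.eq_of_length_eq_zero (p := Q) (by omega))
  have hQ2 : 2 ≤ Q.length := by rcases hQ with ⟨k, hk⟩; omega
  have hP0 := hP.pos
  have hR0 := hR.pos
  obtain ⟨φ, g1, g2, g3, g4, g5, g6, g7⟩ := AB_cont n P.length R.length Q.length hn0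
    (by omega) (by omega) (by omega) hQ0
  have h0 : 0 < φ := h00.trans g1
  have hlt : 2 - 2 * Real.cos (Real.pi / n) < 2 - 2 * Real.cos φ := by
    have := Real.cos_lt_cos_of_nonneg_of_le_pi h00.le g2.le g1
    linarith
  refine lt_of_lt_of_le hlt ?_
  apply le_leastQ
  intro x
  have bP := walk_bound G x φ h0 P hP0 g3
  have bQ := walk_bound G x φ h0 Q hQ0 g5
  have bR := walk_bound G x φ h0 R hR0 g4
  rw [hQ.neg_one_pow, one_mul] at bQ
  rw [hR.neg_one_pow, neg_one_mul] at bR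
  rw [hP.neg_one_pow, neg_one_mul] at bP
  have e := FF_three P.length R.length Q.length φ (x a) (x b)
    (Real.sin_pos_of_pos_of_lt_pi h0 g2) g6 g7
  have d1 := edges_disj P Q h.pP h.pQ h.dPQ hP1
  have d2 := edges_disj P R h.pP h.pR h.dPR hP1
  have d3 := edges_disj Q R h.pQ h.pR h.dQR (by omega)
  have nd : ((P.edges ++ Q.edges) ++ R.edges).Nodup :=
    List.Nodup.append
      (List.Nodup.append h.pP.isTrail.edges_nodup h.pQ.isTrail.edges_nodup d1)
      h.pR.isTrail.edges_nodup (List.disjoint_append_left.mpr ⟨d2, d3⟩)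
  have le := list_le _ nd (fun e => (((G.incMatrix ℝ)ᵀ *ᵥ x) e) ^ 2) (fun _ => sq_nonneg _)
  rw [List.map_append, List.sum_append, List.map_append, List.sum_append] at le
  have sm := h.sum (fun v => x v ^ 2)
  have sm2 : ∑ v, x v ^ 2 = (P.support.map (fun v => x v ^ 2)).sum
    + (Q.support.map (fun v => x v ^ 2)).sum
    + (R.support.map (fun v => x v ^ 2)).sum - 2 * (x a ^ 2 + x b ^ 2) := by linarith
  rw [sm2]
  linarith

theorem edge_idx {V : Type*} {G : SimpleGraph V} {a b : V} (P : G.Walk a b) (e : Sym2 V)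
    (h : e ∈ P.edges) : ∃ m < P.length, e = s(P.getVert m, P.getVert (m + 1)) := by
  induction P with
  | nil => simp at h
  | @cons u v w hh q ih =>
    rw [Walk.edges_cons, List.mem_cons] at h
    rcases h with h | h
    · exact ⟨0, by simp, by simp [h]⟩
    · obtain ⟨m, hm, he⟩ := ih h
      exact ⟨m + 1, by simp [hm], by simpa using he⟩

theorem path_color {V : Type*} {G : SimpleGraph V} {a b : V} (P : G.Walk a b) (hP : P.IsPath) :
    ∃ c : V → ℕ, c a = 0 ∧ c b = P.length ∧ ∀ u v, s(u, v) ∈ P.edges → c u % 2 ≠ c v % 2 := by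
  have hinj := hP.getVert_injOn
  let c : V → ℕ := Function.invFunOn P.getVert {i | i ≤ P.length}
  have hc : ∀ m ≤ P.length, c (P.getVert m) = m := fun m hm =>
    hinj.leftInvOn_invFunOn hm
  refine ⟨c, ?_, ?_, ?_⟩
  · simpa using hc 0 (Nat.zero_le _)
  · simpa using hc P.length le_rfl
  · intro u v h
    obtain ⟨m, hm, he⟩ := edge_idx P _ h
    have e1 := hc m hm.le
    have e2 := hc (m + 1) hm
    rw [Sym2.eq_iff] at he
    rcases he with ⟨rfl, rfl⟩ | ⟨rfl, rfl⟩ <;> omega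

theorem Th.colorable {V : Type*} {G : SimpleGraph V} {a b : V} {P Q R : G.Walk a b}
    (h : Th G a b P Q R) (h1 : Even P.length) (h2 : Even Q.length) (h3 : Even R.length) :
    G.Colorable 2 := by
  obtain ⟨p, pa, pb, pe⟩ := path_color P h.pP
  obtain ⟨q, qa, qb, qe⟩ := path_color Q h.pQ
  obtain ⟨r, ra, rb, re⟩ := path_color R h.pR
  rw [Nat.even_iff] at h1 h2 h3
  let c : V → ℕ := fun v => if v ∈ P.support then p v % 2 else if v ∈ Q.support then q v % 2
    else r v % 2
  have cP : ∀ v ∈ P.support, c v = p v % 2 := fun v hv => by simp [c, hv]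
  have cQ : ∀ v ∈ Q.support, c v = q v % 2 := fun v hv => by
    by_cases hv1 : v ∈ P.support
    · rw [cP v hv1]
      rcases h.dPQ v hv1 hv with rfl | rfl <;> omega
    · simp [c, hv, hv1]
  have cR : ∀ v ∈ R.support, c v = r v % 2 := fun v hv => by
    by_cases hv1 : v ∈ P.support
    · rw [cP v hv1]
      rcases h.dPR v hv1 hv with rfl | rfl <;> omega
    · by_cases hv2 : v ∈ Q.support
      · rw [cQ v hv2]
        rcases h.dQR v hv2 hv with rfl | rfl <;> omega
      · simp [c, hv1, hv2]
  have c2 : ∀ v, c v < 2 := fun v => by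
    simp only [c]
    split_ifs <;> omega
  refine ⟨Coloring.mk (fun v => (⟨c v, c2 v⟩ : Fin 2)) ?_⟩
  intro u v huv heq
  have heq' : c u = c v := congrArg Fin.val heq
  rcases h.edg s(u, v) huv with he | he | he
  · have := pe u v he
    rw [← cP u (Walk.fst_mem_support_of_mem_edges _ he), ← cP v (Walk.snd_mem_support_of_mem_edges _ he)] at this
    exact this heq'
  · have := qe u v he
    rw [← cQ u (Walk.fst_mem_support_of_mem_edges _ he), ← cQ v (Walk.snd_mem_support_of_mem_edges _ he)] at this
    exact this heq'
  · have := re u v he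
    rw [← cR u (Walk.fst_mem_support_of_mem_edges _ he), ← cR v (Walk.snd_mem_support_of_mem_edges _ he)] at this
    exact this heq'

theorem H_adj (n i : ℕ) (k j : Fin n) : (Hgraph n {i}).Adj k j ↔ k ≠ j ∧
    (k.val + 1 = j.val ∨ j.val + 1 = k.val ∨ (k.val + 1 = n ∧ j.val = 0) ∨
      (j.val + 1 = n ∧ k.val = 0) ∨ (k.val = i ∧ j.val = n - i) ∨ (j.val = i ∧ k.val = n - i)) := by
  have hk := k.2
  have hj := j.2
  have m1 : ∀ a < n, (a + 1) % n = if a + 1 = n then 0 else a + 1 := by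
    intro a ha
    split_ifs with hh
    · rw [hh]; simp
    · exact Nat.mod_eq_of_lt (by omega)
  simp only [Hgraph, cycleG, sup_adj, fromRel_adj, ne_eq, Fin.ext_iff, m1 _ hk, m1 _ hj,
    Finset.mem_singleton, exists_eq_left]
  split_ifs <;> omega

theorem iso_H {V : Type*} [Fintype V] {G : SimpleGraph V} {a b : V} {P Q R : G.Walk a b}
    (h : Th G a b P Q R) (n i : ℕ) (hn : 5 ≤ n) (hcard : Fintype.card V = n) (hP : P.length = 1)
    (hQ : Q.length = 2 * i) (hi : 1 ≤ i) (hR1 : 1 ≤ R.length) :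
    Nonempty (G ≃g Hgraph n {i}) := by
  have hR : R.length + 2 * i = n := by have := h.card; omega
  let f : ℕ → V := fun k => if k ≤ i then Q.getVert (i - k) else
    if k ≤ n - i then R.getVert (k - i) else Q.getVert (i + n - k)
  have hQb : Q.getVert (2 * i) = b := hQ ▸ Q.getVert_length
  have hRb : R.getVert R.length = b := R.getVert_length
  have fQ1 : ∀ m ≤ i, f (i - m) = Q.getVert m := by
    intro m hm
    simp only [f, if_pos (show i - m ≤ i by omega)]
    congr 1; omega
  have fR : ∀ m ≤ R.length, f (i + m) = R.getVert m := by
    intro m hm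
    by_cases h0 : m = 0
    · subst h0; simp [f]
    · simp only [f, if_neg (show ¬ i + m ≤ i by omega), if_pos (show i + m ≤ n - i by omega)]
      congr 1; omega
  have fQ2 : ∀ m, i < m → m ≤ 2 * i → f (n + i - m) = Q.getVert m := by
    intro m h1 h2
    by_cases h0 : m = 2 * i
    · subst h0
      rw [hQb, show n + i - 2 * i = i + R.length by omega, fR _ le_rfl, hRb]
    · simp only [f, if_neg (show ¬ n + i - m ≤ i by omega), if_neg (show ¬ n + i - m ≤ n - i by omega)]
      congr 1; omega
  have fa : f i = a := by simpa using fR 0 (Nat.zero_le _)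
  have fb : f (n - i) = b := by
    rw [← hRb, ← fR _ le_rfl]; congr 1; omega
  have hab : G.Adj a b := by
    cases P with
    | nil => simp at hP
    | cons hh q => cases q with
      | nil => exact hh
      | cons _ _ => simp at hP
  have hPs : ∀ v ∈ P.support, v = a ∨ v = b := by
    intro v hv
    cases P with
    | nil => simp at hP
    | cons hh q => cases q with
      | nil => simpa using hv
      | cons _ _ => simp at hP
  have hPe : ∀ e ∈ P.edges, e = s(a, b) := by
    intro v hv
    cases P with
    | nil => simp at hP
    | cons hh q => cases q with
      | nil => simpa using hv
      | cons _ _ => simp at hP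
  let F : Fin n → V := fun k => f k
  have surj : Function.Surjective F := by
    have sQ : ∀ m ≤ 2 * i, ∃ k : Fin n, F k = Q.getVert m := by
      intro m hm
      by_cases h1 : m ≤ i
      · exact ⟨⟨i - m, by omega⟩, fQ1 m h1⟩
      · exact ⟨⟨n + i - m, by omega⟩, fQ2 m (by omega) hm⟩
    intro v
    rcases h.cov v with hv | hv | hv
    · rcases hPs v hv with rfl | rfl
      · exact ⟨⟨i, by omega⟩, fa⟩
      · exact ⟨⟨n - i, by omega⟩, fb⟩
    · obtain ⟨m, rfl, hm⟩ := Walk.mem_support_iff_exists_getVert.mp hv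
      exact sQ m (by omega)
    · obtain ⟨m, rfl, hm⟩ := Walk.mem_support_iff_exists_getVert.mp hv
      exact ⟨⟨i + m, by omega⟩, fR m hm⟩
  have bij : Function.Bijective F := by
    rw [Fintype.bijective_iff_surjective_and_card]
    exact ⟨surj, by simp [hcard]⟩
  have hcyc : ∀ k, k + 1 < n → G.Adj (f k) (f (k + 1)) := by
    intro k hk
    by_cases h1 : k + 1 ≤ i
    · have e1 := fQ1 (i - k) (by omega)
      have e2 := fQ1 (i - (k + 1)) (by omega)
      rw [show i - (i - k) = k by omega] at e1
      rw [show i - (i - (k + 1)) = k + 1 by omega] at e2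
      rw [e1, e2]
      have := Q.adj_getVert_succ (i := i - (k + 1)) (by omega)
      rw [show i - (k + 1) + 1 = i - k by omega] at this
      exact this.symm
    · by_cases h2 : k + 1 ≤ n - i
      · have e1 := fR (k - i) (by omega)
        have e2 := fR (k - i + 1) (by omega)
        rw [show i + (k - i) = k by omega] at e1
        rw [show i + (k - i + 1) = k + 1 by omega] at e2
        rw [e1, e2]
        exact R.adj_getVert_succ (by omega)
      · have e1 := fQ2 (n + i - k) (by omega) (by omega)
        have e2 := fQ2 (n + i - (k + 1)) (by omega) (by omega)
        rw [show n + i - (n + i - k) = k by omega] at e1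
        rw [show n + i - (n + i - (k + 1)) = k + 1 by omega] at e2
        rw [e1, e2]
        have := Q.adj_getVert_succ (i := n + i - (k + 1)) (by omega)
        rw [show n + i - (k + 1) + 1 = n + i - k by omega] at this
        exact this.symm
  have hlast : G.Adj (f (n - 1)) (f 0) := by
    have e1 := fQ2 (i + 1) (by omega) (by omega)
    have e2 := fQ1 i le_rfl
    rw [show n + i - (i + 1) = n - 1 by omega] at e1
    rw [Nat.sub_self] at e2
    rw [e1, e2]
    exact (Q.adj_getVert_succ (i := i) (by omega)).symm
  have hom : ∀ k j : Fin n, (Hgraph n {i}).Adj k j → G.Adj (F k) (F j) := by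
    intro k j hkj
    rw [H_adj] at hkj
    have hk := k.2
    have hj := j.2
    show G.Adj (f k) (f j)
    rcases hkj with ⟨-, e | e | ⟨e1, e2⟩ | ⟨e1, e2⟩ | ⟨e1, e2⟩ | ⟨e1, e2⟩⟩
    · rw [← e]; exact hcyc _ (by omega)
    · rw [← e]; exact (hcyc _ (by omega)).symm
    · rw [e2, show k.val = n - 1 by omega]; exact hlast
    · rw [e2, show j.val = n - 1 by omega]; exact hlast.symm
    · rw [e1, e2, fa, fb]; exact hab
    · rw [e1, e2, fa, fb]; exact hab.symm
  have back : ∀ e ∈ G.edgeSet, ∃ k j : Fin n, (Hgraph n {i}).Adj k j ∧ e = s(F k, F j) := by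
    intro e he
    rcases h.edg e he with he | he | he
    · refine ⟨⟨i, by omega⟩, ⟨n - i, by omega⟩, ?_, ?_⟩
      · rw [H_adj]
        refine ⟨fun hh => ?_, Or.inr (Or.inr (Or.inr (Or.inr (Or.inl ⟨rfl, rfl⟩))))⟩
        have := congrArg Fin.val hh
        simp only at this
        omega
      · rw [hPe e he]
        simp only [F, fa, fb]
    · obtain ⟨m, hm, rfl⟩ := edge_idx Q e he
      by_cases h1 : m + 1 ≤ i
      · refine ⟨⟨i - m, by omega⟩, ⟨i - (m + 1), by omega⟩, ?_, ?_⟩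
        · rw [H_adj]
          simp only [ne_eq, Fin.ext_iff]
          omega
        · simp only [F, fQ1 m (by omega), fQ1 (m + 1) h1]
      · by_cases h2 : m ≤ i
        · refine ⟨⟨i - m, by omega⟩, ⟨n + i - (m + 1), by omega⟩, ?_, ?_⟩
          · rw [H_adj]
            simp only [ne_eq, Fin.ext_iff]
            omega
          · simp only [F, fQ1 m (by omega), fQ2 (m + 1) (by omega) (by omega)]
        · refine ⟨⟨n + i - m, by omega⟩, ⟨n + i - (m + 1), by omega⟩, ?_, ?_⟩
          · rw [H_adj]
            simp only [ne_eq, Fin.ext_iff]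
            omega
          · simp only [F, fQ2 m (by omega) (by omega), fQ2 (m + 1) (by omega) (by omega)]
    · obtain ⟨m, hm, rfl⟩ := edge_idx R e he
      refine ⟨⟨i + m, by omega⟩, ⟨i + (m + 1), by omega⟩, ?_, ?_⟩
      · rw [H_adj]
        simp only [ne_eq, Fin.ext_iff]
        omega
      · simp only [F, fR m hm.le, fR (m + 1) hm]
  refine ⟨RelIso.symm ⟨Equiv.ofBijective F bij, ?_⟩⟩
  intro k j
  constructor
  · intro hG
    obtain ⟨k', j', hH, he⟩ := back s(F k, F j) hG
    rw [Sym2.eq_iff] at he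
    rcases he with ⟨e1, e2⟩ | ⟨e1, e2⟩
    · rw [bij.1 e1, bij.1 e2]; exact hH
    · rw [bij.1 e1, bij.1 e2]; exact hH.symm
  · exact hom k j

theorem H_deg (n i : ℕ) (hi : n = 2 * i + 1) (hn : 5 ≤ n) : Hgraph n {i} = cycleG n := by
  apply le_antisymm _ le_sup_left
  refine sup_le le_rfl ?_
  intro k j hkj
  have hk := k.2
  have hj := j.2
  simp only [fromRel_adj, Finset.mem_singleton, exists_eq_left] at hkj
  simp only [cycleG, fromRel_adj]
  refine ⟨hkj.1, ?_⟩
  rcases hkj.2 with ⟨h1, h2⟩ | ⟨h1, h2⟩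
  · left; rw [Nat.mod_eq_of_lt] <;> omega
  · right; rw [Nat.mod_eq_of_lt] <;> omega

theorem core_one {V : Type*} [Fintype V] {G : SimpleGraph V} {a b : V} {P Q R : G.Walk a b}
    (h : Th G a b P Q R) (n : ℕ) (hn : 5 ≤ n) (hodd : Odd n) (hcard : Fintype.card V = n)
    (hP : P.length = 1) (hQ : Even Q.length) (hR : Odd R.length) :
    leastQEig (cycleG n) ≤ leastQEig G ∧
      (leastQEig (cycleG n) = leastQEig G →
        Nonempty (G ≃g cycleG n) ∨
          ∃ i : ℕ, 1 ≤ i ∧ i ≤ (n - 3) / 2 ∧ Nonempty (G ≃g Hgraph n {i})) := by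
  refine ⟨(cycle_le n hn hodd).trans (bound_two h n hcard hP hQ hR), fun _ => ?_⟩
  have hc := h.card
  have hQ0 : 1 ≤ Q.length := by
    by_contra hh
    exact h.ne (Walk.eq_of_length_eq_zero (p := Q) (by omega))
  obtain ⟨i, hi⟩ := hQ
  have hR0 := hR.pos
  have iso := iso_H h n i hn hcard hP (by omega) (by omega) hR0
  by_cases hR1 : R.length = 1
  · left
    rwa [H_deg n i (by omega) hn] at iso
  · right
    obtain ⟨m, hm⟩ := hR
    exact ⟨i, by omega, by omega, iso⟩

theorem core {V : Type*} [Fintype V] {G : SimpleGraph V} {a b : V} {P Q R : G.Walk a b}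
    (h : Th G a b P Q R) (n : ℕ) (hn : 5 ≤ n) (hodd : Odd n) (hcard : Fintype.card V = n)
    (hP : Odd P.length) (hQ : Even Q.length) (hR : Odd R.length) :
    leastQEig (cycleG n) ≤ leastQEig G ∧
      (leastQEig (cycleG n) = leastQEig G →
        Nonempty (G ≃g cycleG n) ∨
          ∃ i : ℕ, 1 ≤ i ∧ i ≤ (n - 3) / 2 ∧ Nonempty (G ≃g Hgraph n {i})) := by
  by_cases h1 : P.length = 1
  · exact core_one h n hn hodd hcard h1 hQ hR
  by_cases h2 : R.length = 1
  · exact core_one h.swap n hn hodd hcard h2 hQ hP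
  have := (cycle_le n hn hodd).trans_lt (bound_three h n hcard hP hQ hR h1 h2)
  exact ⟨this.le, fun e => absurd e this.ne⟩

theorem stmt13 (n : ℕ) (hn : 5 ≤ n) (hodd : Odd n) {V : Type*} [Fintype V]
    (G : SimpleGraph V) (hcard : Fintype.card V = n)
    (hθ : IsThetaGraph G) (hnb : ¬ G.Colorable 2) :
    leastQEig (cycleG n) ≤ leastQEig G ∧
      (leastQEig (cycleG n) = leastQEig G →
        Nonempty (G ≃g cycleG n) ∨
          ∃ i : ℕ, 1 ≤ i ∧ i ≤ (n - 3) / 2 ∧ Nonempty (G ≃g Hgraph n {i})) := by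
  obtain ⟨-, a, b, hab, P, Q, R, p1, p2, p3, d1, d2, d3, cov, edg⟩ := hθ
  have h : Th G a b P Q R := ⟨hab, p1, p2, p3, d1, d2, d3, cov, edg⟩
  have hc := h.card
  rcases Nat.even_or_odd P.length with e1 | e1 <;> rcases Nat.even_or_odd Q.length with e2 | e2 <;>
    rcases Nat.even_or_odd R.length with e3 | e3
  · exact absurd (h.colorable e1 e2 e3) hnb
  · exfalso; obtain ⟨_, _⟩ := e1; obtain ⟨_, _⟩ := e2; obtain ⟨_, _⟩ := e3
    obtain ⟨_, _⟩ := hodd; omega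
  · exfalso; obtain ⟨_, _⟩ := e1; obtain ⟨_, _⟩ := e2; obtain ⟨_, _⟩ := e3
    obtain ⟨_, _⟩ := hodd; omega
  · exact core h.rot.rot n hn hodd hcard e3 e1 e2
  · exfalso; obtain ⟨_, _⟩ := e1; obtain ⟨_, _⟩ := e2; obtain ⟨_, _⟩ := e3
    obtain ⟨_, _⟩ := hodd; omega
  · exact core h n hn hodd hcard e1 e2 e3
  · exact core h.rot n hn hodd hcard e2 e3 e1
  · exfalso; obtain ⟨_, _⟩ := e1; obtain ⟨_, _⟩ := e2; obtain ⟨_, _⟩ := e3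
    obtain ⟨_, _⟩ := hodd; omega
end
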